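/- Let Ω ⊂ R^n be a bounded Lipschitz domain and 1 ≤ p < q < ∞. Then there is a constant C = C(p,q,Ω) > 0 such that for every ψ ∈ BMO(Ω), ∫_Ω |ψ|^q dx ≤ C ([ψ]_{BMO(Ω)} + |⟨ψ⟩_Ω|)^{q-p} ∫_Ω |ψ|^p dx. -/

import Mathlib

open MeasureTheory Metric Bornology
open scoped ENNReal NNReal
noncomputable section
attribute [local instance] Matrix.frobeniusNormedAddCommGroup Matrix.frobeniusNormedSpace

/-- `ℝⁿ` with the sup metric, so balls are axis-parallel open cubes. -/
abbrev Rn (n : ℕ) := Fin n → ℝ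

/-- `Q` is an axis-parallel open cube compactly contained in `U`. -/
def IsCubeIn {n : ℕ} (U Q : Set (Rn n)) : Prop :=
  (∃ c r, 0 < r ∧ Q = ball c r) ∧ closure Q ⊆ U

/-- Mean oscillation of `ψ` over `Q`. -/
def mo {n : ℕ} {E : Type*} [NormedAddCommGroup E] [NormedSpace ℝ E]
    (Q : Set (Rn n)) (ψ : Rn n → E) : ℝ≥0∞ :=
  (∫⁻ x in Q, ‖ψ x - ⨍ y in Q, ψ y‖₊) / volume Q

/-- The BMO seminorm on `U`: supremum of mean oscillations over axis-parallel
cubes compactly contained in `U`. -/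
def bmo {n : ℕ} {E : Type*} [NormedAddCommGroup E] [NormedSpace ℝ E]
    (U : Set (Rn n)) (ψ : Rn n → E) : ℝ≥0∞ :=
  ⨆ Q, ⨆ (_ : IsCubeIn U Q), mo Q ψ

/-- A bounded Lipschitz domain: a nonempty bounded connected open set whose
boundary is locally the graph of a Lipschitz function, with the domain lying on
one side of the graph.  Near each boundary point there are a unit direction `ν`
and a Lipschitz function `f`, constant in the direction `ν`, such that inside a
neighborhood the domain is the region above the graph `{f y = ∑ i, y i * ν i}`. -/
def IsLipschitzDomain {n : ℕ} (Ω : Set (Rn n)) : Prop :=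
  IsOpen Ω ∧ IsConnected Ω ∧ IsBounded Ω ∧
  ∀ x ∈ frontier Ω, ∃ (U : Set (Rn n)) (ν : Rn n) (f : Rn n → ℝ) (K : ℝ≥0),
    x ∈ U ∧ IsOpen U ∧ (∑ i, ν i * ν i) = 1 ∧ LipschitzWith K f ∧
    (∀ (y : Rn n) (t : ℝ), f (y + t • ν) = f y) ∧
    Ω ∩ U = {y ∈ U | f y < ∑ i, y i * ν i}

theorem ball_ae_eq_closedBall_rn {n : ℕ} (x : Rn n) {r : ℝ} (hr : 0 < r) :
    ball x r =ᵐ[volume] closedBall x r := by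
  refine ae_eq_of_subset_of_measure_ge ball_subset_closedBall ?_
    measurableSet_ball.nullMeasurableSet measure_closedBall_lt_top.ne
  rw [Real.volume_pi_ball x hr, Real.volume_pi_closedBall x hr.le]

theorem volume_ball_le_of_le_mul {n : ℕ} (x y : Rn n) {r s k : ℝ} (hr : 0 < r) (hs : 0 < s)
    (hk : 0 ≤ k) (h : s ≤ k * r) :
    volume (ball y s) ≤ ENNReal.ofReal k ^ n * volume (ball x r) := by
  rw [Real.volume_pi_ball x hr, Real.volume_pi_ball y hs, ← ENNReal.ofReal_pow hk,
    ← ENNReal.ofReal_mul (by positivity), Fintype.card_fin, ← mul_pow]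
  refine ENNReal.ofReal_le_ofReal (pow_le_pow_left₀ (by positivity) ?_ _)
  linarith

theorem volume_ball_pos_rn {n : ℕ} (x : Rn n) {r : ℝ} (hr : 0 < r) : volume (ball x r) ≠ 0 :=
  (measure_ball_pos volume x hr).ne'

theorem volume_ball_ne_top_rn {n : ℕ} (x : Rn n) (r : ℝ) : volume (ball x r) ≠ ⊤ :=
  measure_ball_lt_top.ne

/-- A Vitali-type Calderón–Zygmund selection of balls at height `l`. -/
theorem exists_disjoint_balls_lintegral {n : ℕ} {g : Rn n → ℝ≥0∞} (hg : Measurable g)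
    {c : Rn n} {r : ℝ} (hr : 0 < r) {l : ℝ≥0∞} (hl : l ≠ ⊤)
    (hgl : ∫⁻ x in ball c (2 * r), g x ≤ l * volume (ball c (r / 16))) :
    ∃ u : Set (Rn n × ℝ), u.Countable ∧
      (∀ z ∈ u, z.1 ∈ ball c r ∧ 0 < z.2 ∧ z.2 ≤ r / 32 ∧
        l * volume (ball z.1 z.2) ≤ ∫⁻ x in ball z.1 z.2, g x ∧
        ∫⁻ x in ball z.1 z.2, g x ≤ 2 ^ n * l * volume (ball z.1 z.2)) ∧
      (u.PairwiseDisjoint fun z => ball z.1 z.2) ∧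
      ∀ᵐ x, x ∈ ball c r → l < g x → ∃ z ∈ u, x ∈ ball z.1 (5 * z.2) := by
  classical
  have hpow : ∀ k : ℕ, 0 < r / 2 ^ k := fun k => by positivity
  set t : Set (Rn n × ℝ) := {z | z.1 ∈ ball c r ∧ ∃ k : ℕ, 5 ≤ k ∧ z.2 = r / 2 ^ k ∧
    l * volume (ball z.1 z.2) < ∫⁻ x in ball z.1 z.2, g x ∧
    ∫⁻ x in ball z.1 (2 * z.2), g x ≤ l * volume (ball z.1 (2 * z.2))} with ht
  have htb : ∀ z ∈ t, 0 < z.2 ∧ z.2 ≤ r / 32 := by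
    rintro ⟨x, s⟩ ⟨-, k, hk, hs, -⟩
    simp only at hs ⊢
    subst hs
    refine ⟨hpow k, ?_⟩
    have : (2 : ℝ) ^ 5 ≤ 2 ^ k := pow_le_pow_right₀ (by norm_num) hk
    have h32 : (32 : ℝ) = 2 ^ 5 := by norm_num
    rw [h32]
    gcongr
  obtain ⟨u, hut, hdisj, hcov⟩ := Vitali.exists_disjoint_subfamily_covering_enlargement_closedBall
    t (fun z => z.1) (fun z => z.2) (r / 32) (fun z hz => (htb z hz).2) 4 (by norm_num)
  have hdisj' : u.PairwiseDisjoint fun z => ball z.1 z.2 := fun z hz w hw hzw =>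
    (hdisj hz hw hzw).mono ball_subset_closedBall ball_subset_closedBall
  refine ⟨u, ?_, ?_, hdisj', ?_⟩
  · refine hdisj'.countable_of_nonempty_interior fun z hz => ?_
    rw [isOpen_ball.interior_eq]
    exact nonempty_ball.2 (htb z (hut hz)).1
  · intro z hz
    obtain ⟨h0, h32⟩ := htb z (hut hz)
    obtain ⟨hzc, k, hk, hs, h1, h2⟩ := hut hz
    refine ⟨hzc, h0, h32, h1.le, ?_⟩
    refine (lintegral_mono_set (ball_subset_ball (by linarith))).trans (h2.trans ?_)
    have := volume_ball_le_of_le_mul z.1 z.1 h0 (by positivity : 0 < 2 * z.2) (by norm_num) le_rfl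
    rw [ENNReal.ofReal_ofNat] at this
    calc l * volume (ball z.1 (2 * z.2)) ≤ l * (2 ^ n * volume (ball z.1 z.2)) := by gcongr
      _ = _ := by ring
  · have hfin : ∫⁻ x, (ball c (2 * r)).indicator g x ≠ ⊤ := by
      rw [lintegral_indicator measurableSet_ball]
      exact (hgl.trans_lt (ENNReal.mul_lt_top hl.lt_top measure_ball_lt_top)).ne
    have hd := VitaliFamily.ae_tendsto_lintegral_div
      (IsUnifLocDoublingMeasure.vitaliFamily (volume : Measure (Rn n)) 1)
      (hg.indicator measurableSet_ball).aemeasurable hfin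
    filter_upwards [hd] with x hx hxc hxl
    have hlim : Filter.Tendsto (fun k : ℕ => r / 2 ^ k) Filter.atTop (nhdsWithin 0 (Set.Ioi 0)) := by
      refine tendsto_nhdsWithin_iff.2 ⟨?_, Filter.Eventually.of_forall hpow⟩
      have := (tendsto_pow_atTop_nhds_zero_of_lt_one (r := (1 / 2 : ℝ)) (by norm_num)
        (by norm_num)).const_mul r
      simpa [div_eq_mul_inv] using this
    have hseq := hx.comp (IsUnifLocDoublingMeasure.tendsto_closedBall_filterAt
      (volume : Measure (Rn n)) (K := 1) (x := x) (fun _ => x) (fun k : ℕ => r / 2 ^ k) hlim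
      (Filter.Eventually.of_forall fun k => by
        simpa using (hpow k).le))
    have hsub : ball x r ⊆ ball c (2 * r) := by
      apply ball_subset_ball'
      have := mem_ball.1 hxc
      linarith
    have hgx : (ball c (2 * r)).indicator g x = g x :=
      Set.indicator_of_mem (hsub (mem_ball_self hr)) g
    rw [hgx] at hseq
    have hψint : ∀ k : ℕ, ∫⁻ y in closedBall x (r / 2 ^ k), (ball c (2 * r)).indicator g y =
        ∫⁻ y in ball x (r / 2 ^ k), g y := by
      intro k
      rw [← setLIntegral_congr (ball_ae_eq_closedBall_rn x (hpow k))]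
      refine setLIntegral_congr_fun measurableSet_ball fun y hy => ?_
      refine Set.indicator_of_mem (hsub (ball_subset_ball ?_ hy)) g
      exact div_le_self hr.le (one_le_pow₀ (by norm_num))
    have hev := hseq.eventually (lt_mem_nhds hxl)
    have hex : ∃ k : ℕ, 4 ≤ k ∧
        l * volume (ball x (r / 2 ^ k)) < ∫⁻ y in ball x (r / 2 ^ k), g y := by
      obtain ⟨k, hk, hk4⟩ := (hev.and (Filter.eventually_ge_atTop 4)).exists
      refine ⟨k, hk4, ?_⟩
      simp only [Function.comp, hψint] at hk
      rw [← measure_congr (ball_ae_eq_closedBall_rn x (hpow k))] at hk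
      exact (ENNReal.lt_div_iff_mul_lt (Or.inl (volume_ball_pos_rn x (hpow k)))
        (Or.inl (volume_ball_ne_top_rn x _))).1 hk
    have hspec := Nat.find_spec hex
    have hmin := fun m => Nat.find_min hex (m := m)
    set k := Nat.find hex
    have h16 : ∫⁻ y in ball x (r / 2 ^ 4), g y ≤ l * volume (ball x (r / 2 ^ 4)) := by
      refine (lintegral_mono_set ((ball_subset_ball ?_).trans hsub)).trans (hgl.trans ?_)
      · linarith
      · rw [Real.volume_pi_ball _ (by positivity), Real.volume_pi_ball _ (by positivity)]
        norm_num
    have hk5 : 5 ≤ k := by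
      rcases hspec.1.lt_or_eq with h | h
      · exact h
      · rw [← h] at hspec
        exact absurd hspec.2 h16.not_gt
    have hprev := hmin (k - 1) (by omega)
    simp only [not_and, not_lt] at hprev
    have hprev := hprev (by omega)
    have h2k : r / 2 ^ (k - 1) = 2 * (r / 2 ^ k) := by
      obtain ⟨m, hm⟩ : ∃ m, k = m + 1 := ⟨k - 1, by omega⟩
      rw [hm, Nat.add_sub_cancel, pow_succ]
      field_simp
    rw [h2k] at hprev
    obtain ⟨z, hz, hzb⟩ := hcov (x, r / 2 ^ k) ⟨hxc, k, hk5, rfl, hspec.2, hprev⟩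
    refine ⟨z, hz, ?_⟩
    have h1 := hzb (mem_closedBall_self (hpow k).le)
    refine closedBall_subset_ball ?_ h1
    have := (htb z (hut hz)).1
    linarith

/-- Measurable functions whose mean oscillation is at most one on every open cube with closure
inside `Ω`. -/
structure IsUnitBMO {n : ℕ} (Ω : Set (Rn n)) (ψ : Rn n → ℝ) : Prop where
  measurable : Measurable ψ
  integrableOn : ∀ c r, 0 < r → closedBall c r ⊆ Ω → IntegrableOn ψ (ball c r)
  osc : ∀ c r, 0 < r → closedBall c r ⊆ Ω →
    ∫⁻ x in ball c r, ‖ψ x - ⨍ y in ball c r, ψ y‖ₑ ≤ volume (ball c r)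

theorem setLIntegral_rpow_le_measure_rpow_mul {α : Type*} [MeasurableSpace α] {μ : Measure α}
    {g : α → ℝ≥0∞} (hg : AEMeasurable g μ) {p : ℝ} (hp : 1 ≤ p) :
    (∫⁻ x, g x ∂μ) ^ p ≤ μ Set.univ ^ (p - 1) * ∫⁻ x, g x ^ p ∂μ := by
  have h := eLpNorm'_le_eLpNorm'_mul_rpow_measure_univ (f := g) (μ := μ) one_pos hp
    hg.aestronglyMeasurable
  have hp0 : 0 < p := by linarith
  simp only [eLpNorm', enorm_eq_self, ENNReal.rpow_one, div_one] at h
  calc (∫⁻ x, g x ∂μ) ^ p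
      ≤ ((∫⁻ x, g x ^ p ∂μ) ^ (1 / p) * μ Set.univ ^ (1 - 1 / p)) ^ p := by gcongr
    _ = _ := by
      rw [ENNReal.mul_rpow_of_nonneg _ _ hp0.le, ← ENNReal.rpow_mul, ← ENNReal.rpow_mul, mul_comm]
      congr 2
      · field_simp
      · rw [one_div_mul_cancel hp0.ne', ENNReal.rpow_one]

theorem enorm_setAverage_sub_mul_le {α : Type*} [MeasurableSpace α] {μ : Measure α} {s : Set α}
    {ψ : α → ℝ} (hψ : IntegrableOn ψ s μ) (hs : μ s ≠ ⊤) (k : ℝ) :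
    ‖(⨍ y in s, ψ y ∂μ) - k‖ₑ * μ s ≤ ∫⁻ x in s, ‖ψ x - k‖ₑ ∂μ := by
  have h1 : μ.real s • ((⨍ y in s, ψ y ∂μ) - k) = ∫ x in s, (ψ x - k) ∂μ := by
    rw [smul_sub, measure_smul_setAverage _ hs, integral_sub hψ (integrableOn_const hs),
      setIntegral_const]
  have h2 : μ s = ‖μ.real s‖ₑ := by
    rw [Real.enorm_eq_ofReal measureReal_nonneg, ofReal_measureReal hs]
  calc ‖(⨍ y in s, ψ y ∂μ) - k‖ₑ * μ s = ‖μ.real s • ((⨍ y in s, ψ y ∂μ) - k)‖ₑ := by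
        rw [enorm_smul, ← h2, mul_comm]
    _ ≤ _ := by
        rw [h1]
        exact enorm_integral_le_lintegral_enorm _

theorem IsUnitBMO.enorm_average_sub_average_le {n : ℕ} {Ω : Set (Rn n)} {ψ : Rn n → ℝ}
    (H : IsUnitBMO Ω ψ) {c c' : Rn n} {r r' k : ℝ} (hr : 0 < r) (hr' : 0 < r')
    (hc : closedBall c r ⊆ Ω) (hsub : ball c' r' ⊆ ball c r) (hk : 0 ≤ k) (hrk : r ≤ k * r') :
    ‖(⨍ y in ball c' r', ψ y) - ⨍ y in ball c r, ψ y‖ₑ ≤ ENNReal.ofReal k ^ n := by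
  have h := enorm_setAverage_sub_mul_le ((H.integrableOn c r hr hc).mono_set hsub)
    (volume_ball_ne_top_rn c' r') (⨍ y in ball c r, ψ y)
  refine (ENNReal.mul_le_mul_iff_left (volume_ball_pos_rn c' hr')
    (volume_ball_ne_top_rn c' r')).1 (h.trans ?_)
  exact (lintegral_mono_set hsub).trans ((H.osc c r hr hc).trans
    (volume_ball_le_of_le_mul c' c hr' hr hk hrk))

theorem ENNReal.add_rpow_le_two_rpow_mul (a b : ℝ≥0∞) {q : ℝ} (hq : 1 ≤ q) :
    (a + b) ^ q ≤ 2 ^ q * (a ^ q + b ^ q) := by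
  refine (ENNReal.rpow_add_le_mul_rpow_add_rpow a b hq).trans ?_
  gcongr
  · norm_num
  · linarith

/-- Local comparison of truncated `q`-th powers with `p`-th powers on a cube whose double has small
average oscillation around `k`. -/
theorem IsUnitBMO.setLIntegral_min_rpow_le {n : ℕ} {Ω : Set (Rn n)} {ψ : Rn n → ℝ}
    (H : IsUnitBMO Ω ψ) {p q : ℝ} (hp : 1 ≤ p) (hpq : p ≤ q) {N S : ℝ≥0∞}
    (hS : ∀ c r, 0 < r → closedBall c (2 * r) ⊆ Ω →
      ∫⁻ x in ball c r, min ‖ψ x - ⨍ y in ball c r, ψ y‖ₑ N ^ q ≤ S * volume (ball c r))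
    {c : Rn n} {r : ℝ} (hr : 0 < r) (hc : closedBall c (2 * r) ⊆ Ω) (k : ℝ) {l : ℝ≥0∞}
    (hl1 : 1 ≤ l) (hl : l ≠ ⊤)
    (hk : ∫⁻ x in ball c (2 * r), ‖ψ x - k‖ₑ ≤ l * volume (ball c (r / 16))) :
    ∫⁻ x in ball c r, min ‖ψ x - k‖ₑ N ^ q ≤
      (1 + 2 ^ q * 5 ^ n * (2 * 5 ^ n) ^ q) * (l ^ q + S * l ^ (-p)) *
        ∫⁻ x in ball c (2 * r), ‖ψ x - k‖ₑ ^ p := by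
  have hq : 1 ≤ q := hp.trans hpq
  have hp0 : 0 < p := by linarith
  have hq0 : 0 < q := by linarith
  have hl0 : l ≠ 0 := (one_pos.trans_le hl1).ne'
  have hmeas : Measurable fun x => ‖ψ x - k‖ₑ := (H.measurable.sub_const k).enorm
  obtain ⟨u, hu, hu1, hu2, hu3⟩ := exists_disjoint_balls_lintegral hmeas hr hl hk
  have := hu.to_subtype
  set T := ∫⁻ x in ball c (2 * r), ‖ψ x - k‖ₑ ^ p with hT
  have hTQ : ∫⁻ x in ball c r, ‖ψ x - k‖ₑ ^ p ≤ T :=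
    lintegral_mono_set (ball_subset_ball (by linarith))
  have hball : ∀ z ∈ u, ball z.1 z.2 ⊆ ball c (2 * r) := fun z hz => by
    obtain ⟨h1, h2, h3, -⟩ := hu1 z hz
    apply ball_subset_ball'
    have := mem_ball.1 h1
    linarith
  have hvol : ∀ z ∈ u, volume (ball z.1 z.2) ≤
      l ^ (-p) * ∫⁻ x in ball z.1 z.2, ‖ψ x - k‖ₑ ^ p := by
    intro z hz
    obtain ⟨-, h2, -, h4, -⟩ := hu1 z hz
    have hv0 := volume_ball_pos_rn z.1 h2
    have hvt := volume_ball_ne_top_rn z.1 z.2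
    have hj := setLIntegral_rpow_le_measure_rpow_mul
      (μ := volume.restrict (ball z.1 z.2)) hmeas.aemeasurable hp
    rw [Measure.restrict_apply_univ] at hj
    have h5 : (l * volume (ball z.1 z.2)) ^ p ≤ _ := (ENNReal.rpow_le_rpow h4 hp0.le).trans hj
    set v := volume (ball z.1 z.2)
    have hvp0 : v ^ (p - 1) ≠ 0 := by simp [ENNReal.rpow_eq_zero_iff, hv0, hvt]
    have hvpt : v ^ (p - 1) ≠ ⊤ := ENNReal.rpow_ne_top_of_nonneg (by linarith) hvt
    have hv : v ^ p = v ^ (p - 1) * v := by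
      conv_rhs => rw [← ENNReal.rpow_one v, ← ENNReal.rpow_mul, ← ENNReal.rpow_add _ _ hv0 hvt]
      congr 1
      ring
    rw [ENNReal.mul_rpow_of_nonneg _ _ hp0.le, hv, mul_left_comm,
      ENNReal.mul_le_mul_iff_right hvp0 hvpt] at h5
    calc v = l ^ (-p) * (l ^ p * v) := by
          rw [← mul_assoc, ← ENNReal.rpow_add _ _ hl0 hl, neg_add_cancel, ENNReal.rpow_zero, one_mul]
      _ ≤ _ := by gcongr
  have hpiece : ∀ z ∈ u, ∫⁻ x in ball z.1 (5 * z.2), min ‖ψ x - k‖ₑ N ^ q ≤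
      2 ^ q * (S + (2 * 5 ^ n * l) ^ q) * 5 ^ n * volume (ball z.1 z.2) := by
    intro z hz
    obtain ⟨h1, h2, h3, h4, h5⟩ := hu1 z hz
    have h1' := mem_ball.1 h1
    have hcz : closedBall z.1 (2 * (5 * z.2)) ⊆ Ω := by
      refine (closedBall_subset_closedBall' ?_).trans hc
      linarith
    have hcz' : closedBall z.1 (5 * z.2) ⊆ Ω :=
      (closedBall_subset_closedBall (by linarith)).trans hcz
    have h50 : 0 < 5 * z.2 := by positivity
    have hv0 := volume_ball_pos_rn z.1 h2
    have hvt := volume_ball_ne_top_rn z.1 z.2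
    set m := ⨍ y in ball z.1 (5 * z.2), ψ y with hm
    have hmm : ‖(⨍ y in ball z.1 z.2, ψ y) - m‖ₑ ≤ 5 ^ n := by
      have := H.enorm_average_sub_average_le h50 h2 hcz' (ball_subset_ball (by linarith))
        (by norm_num : (0 : ℝ) ≤ 5) le_rfl
      simpa using this
    have hmk : ‖(⨍ y in ball z.1 z.2, ψ y) - k‖ₑ ≤ 2 ^ n * l := by
      refine (ENNReal.mul_le_mul_iff_left hv0 hvt).1 (le_trans ?_ h5)
      exact enorm_setAverage_sub_mul_le ((H.integrableOn _ _ h50 hcz').mono_set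
        (ball_subset_ball (by linarith))) hvt k
    have hmk' : ‖m - k‖ₑ ≤ 2 * 5 ^ n * l := by
      have e : m - k = ((⨍ y in ball z.1 z.2, ψ y) - k) - ((⨍ y in ball z.1 z.2, ψ y) - m) := by
        ring
      rw [e]
      refine (enorm_sub_le).trans ((add_le_add hmk hmm).trans ?_)
      calc (2 : ℝ≥0∞) ^ n * l + 5 ^ n ≤ 5 ^ n * l + 5 ^ n * l := by
            gcongr
            · norm_num
            · exact le_mul_of_one_le_right' hl1
        _ = _ := by ring
    have hpt : ∀ x, min ‖ψ x - k‖ₑ N ^ q ≤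
        2 ^ q * (min ‖ψ x - m‖ₑ N ^ q + (2 * 5 ^ n * l) ^ q) := by
      intro x
      refine le_trans ?_ (ENNReal.add_rpow_le_two_rpow_mul _ _ hq)
      gcongr
      have : ‖ψ x - k‖ₑ ≤ ‖ψ x - m‖ₑ + 2 * 5 ^ n * l := by
        have e : ψ x - k = (ψ x - m) + (m - k) := by ring
        rw [e]
        exact (enorm_add_le _ _).trans (by gcongr)
      rcases le_total ‖ψ x - m‖ₑ N with h | h
      · rw [min_eq_left h]
        exact (min_le_left _ _).trans this
      · rw [min_eq_right h]
        exact (min_le_right _ _).trans le_self_add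
    calc ∫⁻ x in ball z.1 (5 * z.2), min ‖ψ x - k‖ₑ N ^ q
        ≤ ∫⁻ x in ball z.1 (5 * z.2), 2 ^ q * (min ‖ψ x - m‖ₑ N ^ q + (2 * 5 ^ n * l) ^ q) :=
          lintegral_mono hpt
      _ = 2 ^ q * ((∫⁻ x in ball z.1 (5 * z.2), min ‖ψ x - m‖ₑ N ^ q) +
            (2 * 5 ^ n * l) ^ q * volume (ball z.1 (5 * z.2))) := by
          rw [lintegral_const_mul' _ _ (ENNReal.rpow_ne_top_of_nonneg hq0.le (by norm_num)),
            lintegral_add_right _ measurable_const, setLIntegral_const]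
      _ ≤ 2 ^ q * (S * volume (ball z.1 (5 * z.2)) +
            (2 * 5 ^ n * l) ^ q * volume (ball z.1 (5 * z.2))) := by
          gcongr
          exact hS _ _ h50 hcz
      _ = 2 ^ q * (S + (2 * 5 ^ n * l) ^ q) * volume (ball z.1 (5 * z.2)) := by ring
      _ ≤ 2 ^ q * (S + (2 * 5 ^ n * l) ^ q) * (5 ^ n * volume (ball z.1 z.2)) := by
          gcongr
          have := volume_ball_le_of_le_mul z.1 z.1 h2 h50 (by norm_num : (0 : ℝ) ≤ 5) le_rfl
          simpa using this
      _ = _ := by ring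
  set D := ⋃ z : u, ball z.1.1 (5 * z.1.2) with hD
  have hDm : MeasurableSet D := MeasurableSet.iUnion fun _ => measurableSet_ball
  have hbad : ∫⁻ x in D, min ‖ψ x - k‖ₑ N ^ q ≤
      2 ^ q * (S + (2 * 5 ^ n * l) ^ q) * 5 ^ n * l ^ (-p) * T := by
    calc ∫⁻ x in D, min ‖ψ x - k‖ₑ N ^ q
        ≤ ∑' z : u, ∫⁻ x in ball z.1.1 (5 * z.1.2), min ‖ψ x - k‖ₑ N ^ q := lintegral_iUnion_le _ _
      _ ≤ ∑' z : u, 2 ^ q * (S + (2 * 5 ^ n * l) ^ q) * 5 ^ n *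
            (l ^ (-p) * ∫⁻ x in ball z.1.1 z.1.2, ‖ψ x - k‖ₑ ^ p) :=
          ENNReal.tsum_le_tsum fun z => (hpiece z.1 z.2).trans (by gcongr; exact hvol z.1 z.2)
      _ = 2 ^ q * (S + (2 * 5 ^ n * l) ^ q) * 5 ^ n * l ^ (-p) *
            ∫⁻ x in ⋃ z ∈ u, ball z.1 z.2, ‖ψ x - k‖ₑ ^ p := by
          rw [ENNReal.tsum_mul_left, ENNReal.tsum_mul_left,
            lintegral_biUnion hu (fun _ _ => measurableSet_ball) hu2]
          ring
      _ ≤ _ := by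
          exact mul_le_mul_right (lintegral_mono_set (Set.iUnion₂_subset hball)) _
  have hlq0 : l ^ q ≠ ⊤ := ENNReal.rpow_ne_top_of_nonneg hq0.le hl
  have hgood : ∀ᵐ x, x ∈ ball c r → min ‖ψ x - k‖ₑ N ^ q ≤
      l ^ q * ‖ψ x - k‖ₑ ^ p + D.indicator (fun x => min ‖ψ x - k‖ₑ N ^ q) x := by
    filter_upwards [hu3] with x hx hxc
    rcases le_or_gt ‖ψ x - k‖ₑ l with h | h
    · refine le_trans ?_ le_self_add
      rcases eq_or_ne ‖ψ x - k‖ₑ 0 with h0 | h0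
      · rw [h0, zero_min, ENNReal.zero_rpow_of_pos hq0]
        exact zero_le
      · calc min ‖ψ x - k‖ₑ N ^ q ≤ ‖ψ x - k‖ₑ ^ q := by gcongr; exact min_le_left _ _
          _ = ‖ψ x - k‖ₑ ^ (q - p) * ‖ψ x - k‖ₑ ^ p := by
            rw [← ENNReal.rpow_add _ _ h0 enorm_ne_top, sub_add_cancel]
          _ ≤ l ^ (q - p) * ‖ψ x - k‖ₑ ^ p := by
            gcongr
          _ ≤ l ^ q * ‖ψ x - k‖ₑ ^ p := by
            gcongr ?_ * _
            exact ENNReal.rpow_le_rpow_of_exponent_le hl1 (by linarith)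
    · obtain ⟨z, hz, hxz⟩ := hx hxc h
      have : x ∈ D := Set.mem_iUnion.2 ⟨⟨z, hz⟩, hxz⟩
      rw [Set.indicator_of_mem this]
      exact le_add_self
  have hlp : l ^ q * l ^ (-p) ≤ l ^ q := by
    refine mul_le_of_le_one_right' ?_
    exact ENNReal.rpow_le_one_of_one_le_of_neg hl1 (by linarith)
  calc ∫⁻ x in ball c r, min ‖ψ x - k‖ₑ N ^ q
      ≤ ∫⁻ x in ball c r, (l ^ q * ‖ψ x - k‖ₑ ^ p +
          D.indicator (fun x => min ‖ψ x - k‖ₑ N ^ q) x) :=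
        setLIntegral_mono_ae' measurableSet_ball hgood
    _ = l ^ q * (∫⁻ x in ball c r, ‖ψ x - k‖ₑ ^ p) +
          ∫⁻ x in ball c r, D.indicator (fun x => min ‖ψ x - k‖ₑ N ^ q) x := by
        rw [lintegral_add_left ((hmeas.pow_const p).const_mul _), lintegral_const_mul' _ _ hlq0]
    _ ≤ l ^ q * T + ∫⁻ x in D, min ‖ψ x - k‖ₑ N ^ q := by
        refine add_le_add (by gcongr) ?_
        rw [← lintegral_indicator hDm]
        exact setLIntegral_le_lintegral _ _
    _ ≤ l ^ q * T + 2 ^ q * (S + (2 * 5 ^ n * l) ^ q) * 5 ^ n * l ^ (-p) * T := by gcongr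
    _ = (l ^ q + 2 ^ q * 5 ^ n * (S * l ^ (-p) + (2 * 5 ^ n) ^ q * (l ^ q * l ^ (-p)))) * T := by
        rw [ENNReal.mul_rpow_of_nonneg (2 * 5 ^ n) l hq0.le]
        ring
    _ ≤ (l ^ q + 2 ^ q * 5 ^ n * ((2 * 5 ^ n) ^ q * (S * l ^ (-p)) + (2 * 5 ^ n) ^ q * l ^ q)) *
          T := by
        have h1 : (1 : ℝ≥0∞) ≤ (2 * 5 ^ n) ^ q := by
          refine ENNReal.one_le_rpow ?_ hq0
          calc (1 : ℝ≥0∞) ≤ 5 ^ n := one_le_pow₀ (by norm_num)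
            _ ≤ 2 * 5 ^ n := le_mul_of_one_le_left' (by norm_num)
        have h2 := le_mul_of_one_le_left' (a := S * l ^ (-p)) h1
        gcongr ?_ * _
        exact add_le_add le_rfl (mul_le_mul_right (add_le_add h2 (mul_le_mul_right hlp _)) _)
    _ ≤ (l ^ q + S * l ^ (-p) + 2 ^ q * 5 ^ n *
          ((2 * 5 ^ n) ^ q * (S * l ^ (-p)) + (2 * 5 ^ n) ^ q * l ^ q)) * T := by
        gcongr
        exact le_self_add
    _ = _ := by ring

theorem lintegral_rpow_le_of_forall_min {α : Type*} [MeasurableSpace α] {μ : Measure α}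
    {g : α → ℝ≥0∞} (hg : Measurable g) {q : ℝ} (hq : 0 ≤ q) {M : ℝ≥0∞}
    (h : ∀ N : ℕ, ∫⁻ x, min (g x) N ^ q ∂μ ≤ M) : ∫⁻ x, g x ^ q ∂μ ≤ M := by
  refine le_of_tendsto' (lintegral_tendsto_of_tendsto_of_monotone
    (f := fun (N : ℕ) x => min (g x) N ^ q) (fun N => ?_) ?_ ?_) h
  · exact ((hg.min measurable_const).pow_const q).aemeasurable
  · refine Filter.Eventually.of_forall fun x N N' hN => ?_
    dsimp only
    gcongr
  · refine Filter.Eventually.of_forall fun x => ?_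
    have h1 : Filter.Tendsto (fun N : ℕ => min (g x) N) Filter.atTop (nhds (min (g x) ⊤)) :=
      tendsto_const_nhds.min ENNReal.tendsto_nat_nhds_top
    rw [min_eq_left le_top] at h1
    exact (ENNReal.continuous_rpow_const.tendsto _).comp h1

/-- The `L^q` form of the John–Nirenberg inequality. -/
theorem exists_john_nirenberg (n : ℕ) {q : ℝ} (hq : 1 ≤ q) :
    ∃ C : ℝ≥0∞, C ≠ ⊤ ∧ ∀ (Ω : Set (Rn n)) (ψ : Rn n → ℝ), IsUnitBMO Ω ψ →
      ∀ c r, 0 < r → closedBall c (2 * r) ⊆ Ω →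
        ∫⁻ x in ball c r, ‖ψ x - ⨍ y in ball c r, ψ y‖ₑ ^ q ≤ C * volume (ball c r) := by
  have hq0 : 0 < q := by linarith
  set A : ℝ≥0∞ := 1 + 2 ^ q * 5 ^ n * (2 * 5 ^ n) ^ q with hA
  set D : ℝ≥0∞ := 2 * 4 ^ n with hD
  have hAt : A ≠ ⊤ := by
    have h1 : (2 : ℝ≥0∞) ^ q ≠ ⊤ := ENNReal.rpow_ne_top_of_nonneg hq0.le (by norm_num)
    have h2 : (5 : ℝ≥0∞) ^ n ≠ ⊤ := ENNReal.pow_ne_top (by norm_num)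
    have h3 : (2 * 5 ^ n : ℝ≥0∞) ^ q ≠ ⊤ :=
      ENNReal.rpow_ne_top_of_nonneg hq0.le (ENNReal.mul_ne_top (by norm_num) h2)
    exact ENNReal.add_ne_top.2 ⟨by norm_num, ENNReal.mul_ne_top (ENNReal.mul_ne_top h1 h2) h3⟩
  have hA1 : 1 ≤ A := le_self_add
  have hDt : D ≠ ⊤ := ENNReal.mul_ne_top (by norm_num) (ENNReal.pow_ne_top (by norm_num))
  have hD1 : 1 ≤ D := by
    calc (1 : ℝ≥0∞) ≤ 4 ^ n := one_le_pow₀ (by norm_num)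
      _ ≤ D := le_mul_of_one_le_left' (by norm_num)
  set l : ℝ≥0∞ := 2 * A * D * 16 ^ n with hl
  have hlt : l ≠ ⊤ := ENNReal.mul_ne_top (ENNReal.mul_ne_top (ENNReal.mul_ne_top (by norm_num) hAt)
    hDt) (ENNReal.pow_ne_top (by norm_num))
  have hlD : D * 16 ^ n ≤ l := by
    rw [hl, mul_assoc (2 * A)]
    exact le_mul_of_one_le_left' (one_le_mul (by norm_num) hA1)
  have hlA : 2 * A * D ≤ l := le_mul_of_one_le_right' (one_le_pow₀ (by norm_num))
  have hl1 : 1 ≤ l := le_trans (one_le_mul (one_le_mul (by norm_num) hA1) hD1) hlA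
  have hl0 : l ≠ 0 := (one_pos.trans_le hl1).ne'
  have hlq : l ^ q ≠ ⊤ := ENNReal.rpow_ne_top_of_nonneg hq0.le hlt
  refine ⟨2 * (A * l ^ q * D), ENNReal.mul_ne_top (by norm_num)
    (ENNReal.mul_ne_top (ENNReal.mul_ne_top hAt hlq) hDt), fun Ω ψ H => ?_⟩
  have hmin : ∀ N : ℕ, ∀ c r, 0 < r → closedBall c (2 * r) ⊆ Ω →
      ∫⁻ x in ball c r, min ‖ψ x - ⨍ y in ball c r, ψ y‖ₑ N ^ q ≤
        2 * (A * l ^ q * D) * volume (ball c r) := by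
    intro N
    set S : ℝ≥0∞ := ⨆ (c : Rn n) (r : ℝ) (_ : 0 < r) (_ : closedBall c (2 * r) ⊆ Ω),
      (∫⁻ x in ball c r, min ‖ψ x - ⨍ y in ball c r, ψ y‖ₑ N ^ q) / volume (ball c r) with hSdef
    have hS : ∀ c r, 0 < r → closedBall c (2 * r) ⊆ Ω →
        ∫⁻ x in ball c r, min ‖ψ x - ⨍ y in ball c r, ψ y‖ₑ N ^ q ≤ S * volume (ball c r) := by
      intro c r hr hc
      rw [← ENNReal.div_le_iff (volume_ball_pos_rn c hr) (volume_ball_ne_top_rn c r)]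
      exact le_iSup_of_le c (le_iSup_of_le r (le_iSup_of_le hr (le_iSup_of_le hc le_rfl)))
    have hSt : S ≠ ⊤ := by
      have hN : (N : ℝ≥0∞) ^ q ≠ ⊤ := ENNReal.rpow_ne_top_of_nonneg hq0.le (by simp)
      refine ne_top_of_le_ne_top hN (iSup_le fun c => iSup_le fun r => iSup_le fun hr =>
        iSup_le fun hc => ?_)
      rw [ENNReal.div_le_iff (volume_ball_pos_rn c hr) (volume_ball_ne_top_rn c r),
        ← setLIntegral_const]
      refine lintegral_mono fun x => ?_
      gcongr
      exact min_le_right _ _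
    have hkey : S ≤ A * l ^ q * D + S / 2 := by
      refine iSup_le fun c => iSup_le fun r => iSup_le fun hr => iSup_le fun hc => ?_
      have hvt := volume_ball_ne_top_rn c r
      rw [ENNReal.div_le_iff (volume_ball_pos_rn c hr) hvt]
      have h2r : 0 < 2 * r := by positivity
      set m := ⨍ y in ball c r, ψ y with hm
      set m2 := ⨍ y in ball c (2 * r), ψ y with hm2
      have hmm : ‖m2 - m‖ₑ ≤ 2 ^ n := by
        rw [enorm_sub_rev]
        have := H.enorm_average_sub_average_le h2r hr hc (ball_subset_ball (by linarith))
          (by norm_num : (0 : ℝ) ≤ 2) le_rfl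
        simpa using this
      have hv2 : volume (ball c (2 * r)) ≤ 2 ^ n * volume (ball c r) := by
        have := volume_ball_le_of_le_mul c c hr h2r (by norm_num : (0 : ℝ) ≤ 2) le_rfl
        simpa using this
      have hv16 : volume (ball c r) ≤ 16 ^ n * volume (ball c (r / 16)) := by
        have := volume_ball_le_of_le_mul c c (by positivity : 0 < r / 16) hr
          (by norm_num : (0 : ℝ) ≤ 16) (by linarith)
        simpa using this
      have hosc : ∫⁻ x in ball c (2 * r), ‖ψ x - m‖ₑ ≤ D * volume (ball c r) := by
        calc ∫⁻ x in ball c (2 * r), ‖ψ x - m‖ₑ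
            ≤ ∫⁻ x in ball c (2 * r), (‖ψ x - m2‖ₑ + 2 ^ n) := by
              refine lintegral_mono fun x => ?_
              have e : ψ x - m = (ψ x - m2) + (m2 - m) := by ring
              dsimp only
              rw [e]
              exact (enorm_add_le _ _).trans (by gcongr)
          _ ≤ volume (ball c (2 * r)) + 2 ^ n * volume (ball c (2 * r)) := by
              rw [lintegral_add_right _ measurable_const, setLIntegral_const]
              gcongr
              exact H.osc _ _ h2r hc
          _ ≤ 2 ^ n * volume (ball c (2 * r)) + 2 ^ n * volume (ball c (2 * r)) := by
              gcongr
              exact le_mul_of_one_le_left' (one_le_pow₀ (by norm_num))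
          _ = 2 * 2 ^ n * volume (ball c (2 * r)) := by ring
          _ ≤ 2 * 2 ^ n * (2 ^ n * volume (ball c r)) := by gcongr
          _ = D * volume (ball c r) := by
              have h4 : (4 : ℝ≥0∞) = 2 * 2 := by norm_num
              rw [hD, h4, mul_pow]
              ring
      have hmain := H.setLIntegral_min_rpow_le le_rfl hq hS hr hc m hl1 hlt (hosc.trans (by
        calc D * volume (ball c r) ≤ D * (16 ^ n * volume (ball c (r / 16))) := by gcongr
          _ = D * 16 ^ n * volume (ball c (r / 16)) := by ring
          _ ≤ _ := by gcongr))
      simp only [ENNReal.rpow_one, ENNReal.rpow_neg_one] at hmain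
      refine hmain.trans ?_
      calc A * (l ^ q + S * l⁻¹) * ∫⁻ x in ball c (2 * r), ‖ψ x - m‖ₑ
          ≤ A * (l ^ q + S * l⁻¹) * (D * volume (ball c r)) := by gcongr
        _ = (A * l ^ q * D + S * (A * D * l⁻¹)) * volume (ball c r) := by ring
        _ ≤ (A * l ^ q * D + S * 2⁻¹) * volume (ball c r) := by
            gcongr
            rw [← div_eq_mul_inv, ENNReal.div_le_iff hl0 hlt]
            calc A * D = 2⁻¹ * (2 * A * D) := by
                  rw [mul_assoc 2 A D, ← mul_assoc 2⁻¹,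
                    ENNReal.inv_mul_cancel (by norm_num) (by norm_num), one_mul]
              _ ≤ _ := by gcongr
        _ = _ := by rw [div_eq_mul_inv]
    have hS2 : S ≤ 2 * (A * l ^ q * D) := by
      have h2 : S / 2 ≤ A * l ^ q * D := by
        have h3 : S / 2 ≠ ⊤ := ENNReal.div_ne_top hSt (by norm_num)
        refine (ENNReal.add_le_add_iff_right h3).1 ?_
        rwa [ENNReal.add_halves]
      rw [ENNReal.div_le_iff (by norm_num) (by norm_num)] at h2
      rwa [mul_comm]
    intro c r hr hc
    exact (hS c r hr hc).trans (by gcongr)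
  intro c r hr hc
  exact lintegral_rpow_le_of_forall_min (H.measurable.sub_const _).enorm hq0.le
    fun N => hmin N c r hr hc

theorem exists_setLIntegral_rpow_le (n : ℕ) {p q : ℝ} (hp : 1 ≤ p) (hpq : p ≤ q) :
    ∃ C : ℝ≥0∞, C ≠ ⊤ ∧ ∀ (Ω : Set (Rn n)) (ψ : Rn n → ℝ), IsUnitBMO Ω ψ →
      ∀ c r, 0 < r → closedBall c (2 * r) ⊆ Ω →
        ∫⁻ x in ball c r, ‖ψ x‖ₑ ^ q ≤ C * ((∫⁻ x in ball c (2 * r), ‖ψ x‖ₑ ^ p) +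
          ((∫⁻ x in ball c (2 * r), ‖ψ x‖ₑ) / volume (ball c (2 * r))) ^ q *
            volume (ball c r)) := by
  have hq : 1 ≤ q := hp.trans hpq
  have hq0 : 0 < q := by linarith
  obtain ⟨J, hJ, hJN⟩ := exists_john_nirenberg n hq
  set A : ℝ≥0∞ := (1 + 2 ^ q * 5 ^ n * (2 * 5 ^ n) ^ q) *
    (((32 : ℝ≥0∞) ^ n) ^ q + J * ((32 : ℝ≥0∞) ^ n) ^ (-p)) with hA
  set A' : ℝ≥0∞ := 2 ^ q * (J + (2 ^ n) ^ q) with hA'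
  have h32 : 1 ≤ (32 : ℝ≥0∞) ^ n := one_le_pow₀ (by norm_num)
  have h32t : (32 : ℝ≥0∞) ^ n ≠ ⊤ := ENNReal.pow_ne_top (by norm_num)
  have h2q : (2 : ℝ≥0∞) ^ q ≠ ⊤ := ENNReal.rpow_ne_top_of_nonneg hq0.le (by norm_num)
  have hAt : A ≠ ⊤ := by
    have h2 : (5 : ℝ≥0∞) ^ n ≠ ⊤ := ENNReal.pow_ne_top (by norm_num)
    have h3 : (2 * 5 ^ n : ℝ≥0∞) ^ q ≠ ⊤ :=
      ENNReal.rpow_ne_top_of_nonneg hq0.le (ENNReal.mul_ne_top (by norm_num) h2)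
    have h4 : ((32 : ℝ≥0∞) ^ n) ^ (-p) ≤ 1 :=
      ENNReal.rpow_le_one_of_one_le_of_neg h32 (by linarith)
    refine ENNReal.mul_ne_top (ENNReal.add_ne_top.2 ⟨by norm_num,
      ENNReal.mul_ne_top (ENNReal.mul_ne_top h2q h2) h3⟩) (ENNReal.add_ne_top.2
      ⟨ENNReal.rpow_ne_top_of_nonneg hq0.le h32t,
        ENNReal.mul_ne_top hJ (ne_top_of_le_ne_top (by norm_num) h4)⟩)
  have hAt' : A' ≠ ⊤ := ENNReal.mul_ne_top h2q (ENNReal.add_ne_top.2 ⟨hJ,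
    ENNReal.rpow_ne_top_of_nonneg hq0.le (ENNReal.pow_ne_top (by norm_num))⟩)
  refine ⟨A + A', ENNReal.add_ne_top.2 ⟨hAt, hAt'⟩, fun Ω ψ H c r hr hc => ?_⟩
  have h2r : 0 < 2 * r := by positivity
  have hc' : closedBall c r ⊆ Ω := (closedBall_subset_closedBall (by linarith)).trans hc
  have hv0 := volume_ball_pos_rn c hr
  have hvt := volume_ball_ne_top_rn c r
  have hw0 := volume_ball_pos_rn c h2r
  have hwt := volume_ball_ne_top_rn c (2 * r)
  set a := (∫⁻ x in ball c (2 * r), ‖ψ x‖ₑ) / volume (ball c (2 * r)) with ha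
  have haI : ∫⁻ x in ball c (2 * r), ‖ψ x‖ₑ = a * volume (ball c (2 * r)) := by
    rw [ha, ENNReal.div_mul_cancel hw0 hwt]
  rcases le_total a 1 with h | h
  · refine le_trans ?_ (mul_le_mul' (le_self_add : A ≤ A + A') le_self_add)
    refine lintegral_rpow_le_of_forall_min H.measurable.enorm hq0.le fun N => ?_
    have hk : ∫⁻ x in ball c (2 * r), ‖ψ x - 0‖ₑ ≤ 32 ^ n * volume (ball c (r / 16)) := by
      simp only [sub_zero]
      rw [haI]
      have := volume_ball_le_of_le_mul c c (by positivity : 0 < r / 16) h2r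
          (by norm_num : (0 : ℝ) ≤ 32) (by linarith)
      rw [ENNReal.ofReal_ofNat] at this
      exact (mul_le_of_le_one_left' h).trans this
    have := H.setLIntegral_min_rpow_le (N := N) (S := J) hp hpq (fun c r hr hc =>
      (lintegral_mono fun x => ENNReal.rpow_le_rpow (min_le_left _ _) hq0.le).trans
        (hJN Ω ψ H c r hr hc)) hr hc 0 h32 h32t hk
    simpa only [sub_zero] using this
  · refine le_trans ?_ (mul_le_mul' (le_add_self : A' ≤ A + A') le_add_self)
    set m := ⨍ y in ball c r, ψ y with hm
    have hma : ‖m‖ₑ ≤ 2 ^ n * a := by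
      refine (ENNReal.mul_le_mul_iff_left hv0 hvt).1 ?_
      have h1 := enorm_setAverage_sub_mul_le (H.integrableOn c r hr hc') hvt 0
      simp only [sub_zero] at h1
      refine h1.trans ((lintegral_mono_set (ball_subset_ball (by linarith))).trans
        (haI.le.trans ?_))
      have := volume_ball_le_of_le_mul c c hr h2r (by norm_num : (0 : ℝ) ≤ 2) le_rfl
      rw [ENNReal.ofReal_ofNat] at this
      calc a * volume (ball c (2 * r)) ≤ a * (2 ^ n * volume (ball c r)) := by gcongr
        _ = _ := by ring
    calc ∫⁻ x in ball c r, ‖ψ x‖ₑ ^ q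
        ≤ ∫⁻ x in ball c r, 2 ^ q * (‖ψ x - m‖ₑ ^ q + (2 ^ n * a) ^ q) := by
          refine lintegral_mono fun x => ?_
          refine le_trans ?_ (ENNReal.add_rpow_le_two_rpow_mul _ _ hq)
          dsimp only
          gcongr
          calc ‖ψ x‖ₑ = ‖(ψ x - m) + m‖ₑ := by rw [sub_add_cancel]
            _ ≤ _ := (enorm_add_le _ _).trans (by gcongr)
      _ = 2 ^ q * ((∫⁻ x in ball c r, ‖ψ x - m‖ₑ ^ q) + (2 ^ n * a) ^ q * volume (ball c r)) := by
          rw [lintegral_const_mul' _ _ h2q, lintegral_add_right _ measurable_const,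
            setLIntegral_const]
      _ ≤ 2 ^ q * (J * volume (ball c r) + (2 ^ n * a) ^ q * volume (ball c r)) := by
          gcongr
          exact hJN Ω ψ H c r hr hc
      _ ≤ 2 ^ q * (J * a ^ q * volume (ball c r) + (2 ^ n * a) ^ q * volume (ball c r)) := by
          have h1 : J ≤ J * a ^ q := le_mul_of_one_le_right' (ENNReal.one_le_rpow h hq0)
          gcongr
      _ = _ := by
          rw [ENNReal.mul_rpow_of_nonneg _ _ hq0.le, hA']
          ring

/-- The average of `g` over the cube centred at `x` whose radius is `s` times the distance of `x`
to the complement of `Ω`. -/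
def whitneyAvg {n : ℕ} (Ω : Set (Rn n)) (s : ℝ) (g : Rn n → ℝ≥0∞) (x : Rn n) : ℝ≥0∞ :=
  (∫⁻ y in ball x (s * infDist x Ωᶜ), g y) / volume (ball x (s * infDist x Ωᶜ))

theorem measurableSet_whitney_ball {n : ℕ} (Ω : Set (Rn n)) (s : ℝ) :
    MeasurableSet {z : Rn n × Rn n | z.2 ∈ ball z.1 (s * infDist z.1 Ωᶜ)} := by
  have h1 : Continuous fun z : Rn n × Rn n => dist z.2 z.1 := by fun_prop
  have h2 : Continuous fun z : Rn n × Rn n => s * infDist z.1 Ωᶜ :=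
    continuous_const.mul ((continuous_infDist_pt Ωᶜ).comp continuous_fst)
  exact (isOpen_lt h1 h2).measurableSet

theorem measurable_setLIntegral_whitney_ball {n : ℕ} (Ω : Set (Rn n)) (s : ℝ) {g : Rn n → ℝ≥0∞}
    (hg : Measurable g) : Measurable fun x => ∫⁻ y in ball x (s * infDist x Ωᶜ), g y := by
  have h : Measurable fun z : Rn n × Rn n =>
      {z : Rn n × Rn n | z.2 ∈ ball z.1 (s * infDist z.1 Ωᶜ)}.indicator (fun z => g z.2) z :=
    (hg.comp measurable_snd).indicator (measurableSet_whitney_ball Ω s)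
  have h2 := h.lintegral_prod_right' (ν := (volume : Measure (Rn n)))
  convert h2 using 2 with x
  rw [← lintegral_indicator measurableSet_ball]
  rfl

theorem measurable_whitneyAvg {n : ℕ} (Ω : Set (Rn n)) (s : ℝ) {g : Rn n → ℝ≥0∞}
    (hg : Measurable g) : Measurable (whitneyAvg Ω s g) := by
  refine (measurable_setLIntegral_whitney_ball Ω s hg).div ?_
  have := measurable_setLIntegral_whitney_ball Ω s (measurable_const (a := (1 : ℝ≥0∞)))
  simpa only [setLIntegral_one] using this

theorem infDist_compl_pos {n : ℕ} {Ω : Set (Rn n)} (hΩ : IsOpen Ω) (hne : Ωᶜ.Nonempty) {x : Rn n}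
    (hx : x ∈ Ω) : 0 < infDist x Ωᶜ :=
  (hΩ.isClosed_compl.notMem_iff_infDist_pos hne).1 (fun h => h hx)

theorem closedBall_subset_of_lt_infDist_compl {n : ℕ} {Ω : Set (Rn n)} {x : Rn n} {r : ℝ}
    (hr : r < infDist x Ωᶜ) : closedBall x r ⊆ Ω :=
  (closedBall_subset_ball hr).trans ball_infDist_compl_subset

/-- The kernel of `whitneyAvg`. -/
def whitneyKernel {n : ℕ} (Ω : Set (Rn n)) (s : ℝ) (x y : Rn n) : ℝ≥0∞ :=
  (ball x (s * infDist x Ωᶜ)).indicator (fun _ => (volume (ball x (s * infDist x Ωᶜ)))⁻¹) y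

theorem measurable_whitneyKernel {n : ℕ} (Ω : Set (Rn n)) (s : ℝ) :
    Measurable (Function.uncurry (whitneyKernel Ω s)) := by
  have := measurable_setLIntegral_whitney_ball Ω s (measurable_const (a := (1 : ℝ≥0∞)))
  simp only [setLIntegral_one] at this
  exact (this.inv.comp measurable_fst).indicator (measurableSet_whitney_ball Ω s)

theorem setLIntegral_whitneyAvg {n : ℕ} (Ω : Set (Rn n)) (s : ℝ) {g : Rn n → ℝ≥0∞}
    (hg : Measurable g) :
    ∫⁻ x in Ω, whitneyAvg Ω s g x = ∫⁻ y, g y * ∫⁻ x in Ω, whitneyKernel Ω s x y := by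
  have hm := measurable_whitneyKernel Ω s
  have h1 : ∀ x, whitneyAvg Ω s g x = ∫⁻ y, g y * whitneyKernel Ω s x y := by
    intro x
    rw [whitneyAvg, div_eq_mul_inv, ← lintegral_mul_const _ hg,
      ← lintegral_indicator measurableSet_ball]
    refine lintegral_congr fun y => ?_
    by_cases hy : y ∈ ball x (s * infDist x Ωᶜ)
    · rw [whitneyKernel, Set.indicator_of_mem hy, Set.indicator_of_mem hy]
    · rw [whitneyKernel, Set.indicator_of_notMem hy, Set.indicator_of_notMem hy, mul_zero]
  simp only [h1]
  rw [lintegral_lintegral_swap]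
  · refine lintegral_congr fun y => ?_
    rw [lintegral_const_mul]
    exact hm.of_uncurry_right
  · exact ((hg.comp measurable_snd).mul hm).aemeasurable

theorem infDist_le_two_mul_of_dist_lt {n : ℕ} {Ω : Set (Rn n)} {s : ℝ} (hs : s ≤ 1 / 2)
    {x y : Rn n} (h : dist x y < s * infDist x Ωᶜ) : infDist x Ωᶜ ≤ 2 * infDist y Ωᶜ := by
  have h1 := infDist_le_infDist_add_dist (s := Ωᶜ) (x := x) (y := y)
  have h2 := infDist_nonneg (s := Ωᶜ) (x := x)
  nlinarith

theorem setLIntegral_whitneyAvg_le {n : ℕ} {Ω : Set (Rn n)} (hΩ : IsOpen Ω) (hne : Ωᶜ.Nonempty)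
    {s : ℝ} (hs0 : 0 < s) (hs : s ≤ 1 / 2) {g : Rn n → ℝ≥0∞} (hg : Measurable g) :
    ∫⁻ x in Ω, whitneyAvg Ω s g x ≤ 4 ^ n * ∫⁻ x in Ω, g x := by
  rw [setLIntegral_whitneyAvg Ω s hg, ← lintegral_indicator hΩ.measurableSet,
    ← lintegral_const_mul' _ _ (ENNReal.pow_ne_top (by norm_num))]
  refine lintegral_mono fun y => ?_
  dsimp only
  by_cases hy : y ∈ Ω
  · rw [Set.indicator_of_mem hy, mul_comm]
    gcongr
    have hy0 := infDist_compl_pos hΩ hne hy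
    have hr : 0 < 2 * (s * infDist y Ωᶜ) := by positivity
    have hv0 := volume_ball_pos_rn y hr
    have hvt := volume_ball_ne_top_rn y (2 * (s * infDist y Ωᶜ))
    calc ∫⁻ x in Ω, whitneyKernel Ω s x y
        ≤ ∫⁻ x in Ω, (ball y (2 * (s * infDist y Ωᶜ))).indicator
            (fun _ => 4 ^ n / volume (ball y (2 * (s * infDist y Ωᶜ)))) x := by
          refine setLIntegral_mono' hΩ.measurableSet fun x hx => ?_
          have hx0 := infDist_compl_pos hΩ hne hx
          by_cases hxy : y ∈ ball x (s * infDist x Ωᶜ)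
          · have hd : dist x y < s * infDist x Ωᶜ := by rw [dist_comm]; exact hxy
            have h2 := infDist_le_two_mul_of_dist_lt hs hd
            have h2' : infDist y Ωᶜ ≤ 2 * infDist x Ωᶜ := by
              have h1 := infDist_le_infDist_add_dist (s := Ωᶜ) (x := y) (y := x)
              rw [dist_comm] at h1
              nlinarith
            have hmem : x ∈ ball y (2 * (s * infDist y Ωᶜ)) := by
              rw [mem_ball]
              nlinarith
            rw [whitneyKernel, Set.indicator_of_mem hxy, Set.indicator_of_mem hmem]
            have := volume_ball_le_of_le_mul x y (by positivity : 0 < s * infDist x Ωᶜ) hr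
              (by norm_num : (0 : ℝ) ≤ 4) (by nlinarith)
            rw [ENNReal.ofReal_ofNat] at this
            rw [ENNReal.le_div_iff_mul_le (Or.inl hv0) (Or.inl hvt), mul_comm, ← div_eq_mul_inv]
            exact ENNReal.div_le_of_le_mul this
          · rw [whitneyKernel, Set.indicator_of_notMem hxy]
            exact zero_le
      _ ≤ ∫⁻ x, (ball y (2 * (s * infDist y Ωᶜ))).indicator
            (fun _ => 4 ^ n / volume (ball y (2 * (s * infDist y Ωᶜ)))) x :=
          setLIntegral_le_lintegral _ _
      _ = 4 ^ n := by
          rw [lintegral_indicator measurableSet_ball, setLIntegral_const,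
            ENNReal.div_mul_cancel hv0 hvt]
  · rw [Set.indicator_of_notMem hy, mul_zero, nonpos_iff_eq_zero]
    refine mul_eq_zero_of_right _ ?_
    rw [setLIntegral_congr_fun hΩ.measurableSet (g := fun _ => 0), lintegral_zero]
    intro x hx
    refine Set.indicator_of_notMem (fun h => hy ?_) _
    refine (closedBall_subset_of_lt_infDist_compl (x := x) ?_) (ball_subset_closedBall h)
    have hx0 := infDist_compl_pos hΩ hne hx
    nlinarith

theorem setLIntegral_le_whitneyAvg {n : ℕ} {Ω : Set (Rn n)} (hΩ : IsOpen Ω) (hne : Ωᶜ.Nonempty)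
    {s : ℝ} (hs0 : 0 < s) (hs : s ≤ 1 / 2) {g : Rn n → ℝ≥0∞} (hg : Measurable g) :
    ∫⁻ x in Ω, g x ≤ 4 ^ n * ∫⁻ x in Ω, whitneyAvg Ω s g x := by
  rw [setLIntegral_whitneyAvg Ω s hg, ← lintegral_indicator hΩ.measurableSet,
    ← lintegral_const_mul' _ _ (ENNReal.pow_ne_top (by norm_num))]
  refine lintegral_mono fun y => ?_
  dsimp only
  by_cases hy : y ∈ Ω
  swap
  · rw [Set.indicator_of_notMem hy]
    exact zero_le
  rw [Set.indicator_of_mem hy, mul_left_comm]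
  refine le_mul_of_one_le_right' ?_
  have hy0 := infDist_compl_pos hΩ hne hy
  have hr : 0 < s * infDist y Ωᶜ / 2 := by positivity
  have hsub : ball y (s * infDist y Ωᶜ / 2) ⊆ Ω :=
    ball_subset_closedBall.trans (closedBall_subset_of_lt_infDist_compl (by nlinarith))
  have hv0 := volume_ball_pos_rn y hr
  have hvt := volume_ball_ne_top_rn y (s * infDist y Ωᶜ / 2)
  set v := volume (ball y (s * infDist y Ωᶜ / 2)) with hv
  have h4 : (4 : ℝ≥0∞) ^ n ≠ 0 := by positivity
  have h4t : (4 : ℝ≥0∞) ^ n ≠ ⊤ := ENNReal.pow_ne_top (by norm_num)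
  calc (1 : ℝ≥0∞) = 4 ^ n * ((4 ^ n * v)⁻¹ * v) := by
        rw [ENNReal.mul_inv (Or.inl h4) (Or.inl h4t), mul_assoc, ENNReal.inv_mul_cancel hv0 hvt,
          mul_one, ENNReal.mul_inv_cancel h4 h4t]
    _ = 4 ^ n * ∫⁻ x in ball y (s * infDist y Ωᶜ / 2), (4 ^ n * v)⁻¹ := by
        rw [setLIntegral_const]
    _ ≤ 4 ^ n * ∫⁻ x in ball y (s * infDist y Ωᶜ / 2), whitneyKernel Ω s x y := by
        gcongr 4 ^ n * ?_
        refine setLIntegral_mono' measurableSet_ball fun x hx => ?_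
        have hd := mem_ball.1 hx
        have h1 := infDist_le_infDist_add_dist (s := Ωᶜ) (x := x) (y := y)
        have h2 := infDist_le_infDist_add_dist (s := Ωᶜ) (x := y) (y := x)
        rw [dist_comm y x] at h2
        have hmem : y ∈ ball x (s * infDist x Ωᶜ) := by
          rw [mem_ball, dist_comm]
          nlinarith
        rw [whitneyKernel, Set.indicator_of_mem hmem, ENNReal.inv_le_inv]
        have := volume_ball_le_of_le_mul y x hr (by nlinarith : 0 < s * infDist x Ωᶜ)
          (by norm_num : (0 : ℝ) ≤ 4) (by nlinarith)
        rwa [ENNReal.ofReal_ofNat] at this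
    _ ≤ 4 ^ n * ∫⁻ x in Ω, whitneyKernel Ω s x y :=
        mul_le_mul_right (lintegral_mono_set hsub) _

theorem whitneyAvg_rpow_le {n : ℕ} {Ω : Set (Rn n)} (hΩ : IsOpen Ω) (hne : Ωᶜ.Nonempty)
    {s : ℝ} (hs0 : 0 < s) {g : Rn n → ℝ≥0∞} (hg : Measurable g) {p : ℝ} (hp : 1 ≤ p) {x : Rn n}
    (hx : x ∈ Ω) : whitneyAvg Ω s g x ^ p ≤ whitneyAvg Ω s (fun y => g y ^ p) x := by
  have hr : 0 < s * infDist x Ωᶜ := mul_pos hs0 (infDist_compl_pos hΩ hne hx)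
  have hv0 := volume_ball_pos_rn x hr
  have hvt := volume_ball_ne_top_rn x (s * infDist x Ωᶜ)
  have hj := setLIntegral_rpow_le_measure_rpow_mul
    (μ := volume.restrict (ball x (s * infDist x Ωᶜ))) hg.aemeasurable hp
  rw [Measure.restrict_apply_univ] at hj
  rw [whitneyAvg, whitneyAvg, ENNReal.div_rpow_of_nonneg _ _ (by linarith),
    ENNReal.div_le_iff (by simp [ENNReal.rpow_eq_zero_iff, hv0, hvt])
      (ENNReal.rpow_ne_top_of_nonneg (by linarith) hvt)]
  refine hj.trans (le_of_eq ?_)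
  set v := volume (ball x (s * infDist x Ωᶜ))
  rw [ENNReal.rpow_sub _ _ hv0 hvt, ENNReal.rpow_one, div_eq_mul_inv, div_eq_mul_inv]
  ring

/-- On an open set, the `q`-th power integral of a function with unit oscillation is controlled by
its `p`-th power integral and the `q`-th powers of its averages over Whitney cubes. -/
theorem exists_setLIntegral_rpow_le_whitneyAvg (n : ℕ) {p q : ℝ} (hp : 1 ≤ p) (hpq : p ≤ q) :
    ∃ C : ℝ≥0∞, C ≠ ⊤ ∧ ∀ (Ω : Set (Rn n)) (ψ : Rn n → ℝ), IsOpen Ω → Ωᶜ.Nonempty →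
      IsUnitBMO Ω ψ →
        ∫⁻ x in Ω, ‖ψ x‖ₑ ^ q ≤ C * ((∫⁻ x in Ω, ‖ψ x‖ₑ ^ p) +
          ∫⁻ x in Ω, whitneyAvg Ω (1 / 4) (fun y => ‖ψ y‖ₑ) x ^ q) := by
  obtain ⟨C, hC, h⟩ := exists_setLIntegral_rpow_le n hp hpq
  have h4t : (4 : ℝ≥0∞) ^ n ≠ ⊤ := ENNReal.pow_ne_top (by norm_num)
  have h2t : (2 : ℝ≥0∞) ^ n ≠ ⊤ := ENNReal.pow_ne_top (by norm_num)
  have h21 : 1 ≤ (2 : ℝ≥0∞) ^ n := one_le_pow₀ (by norm_num)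
  have h41 : 1 ≤ (4 : ℝ≥0∞) ^ n := one_le_pow₀ (by norm_num)
  refine ⟨4 ^ n * (C * (2 ^ n * 4 ^ n)), ENNReal.mul_ne_top h4t (ENNReal.mul_ne_top hC
    (ENNReal.mul_ne_top h2t h4t)), fun Ω ψ hΩ hne H => ?_⟩
  have hm := H.measurable.enorm
  have hpt : ∀ x ∈ Ω, whitneyAvg Ω (1 / 8) (fun y => ‖ψ y‖ₑ ^ q) x ≤
      C * (2 ^ n * whitneyAvg Ω (1 / 4) (fun y => ‖ψ y‖ₑ ^ p) x +
        whitneyAvg Ω (1 / 4) (fun y => ‖ψ y‖ₑ) x ^ q) := by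
    intro x hx
    have hx0 := infDist_compl_pos hΩ hne hx
    have hr : 0 < 1 / 8 * infDist x Ωᶜ := by positivity
    have e : 2 * (1 / 8 * infDist x Ωᶜ) = 1 / 4 * infDist x Ωᶜ := by ring
    have hr4 : 0 < 1 / 4 * infDist x Ωᶜ := by positivity
    have hmain := h Ω ψ H x _ hr (closedBall_subset_of_lt_infDist_compl (by linarith))
    rw [e] at hmain
    have hv0 := volume_ball_pos_rn x hr
    have hvt := volume_ball_ne_top_rn x (1 / 8 * infDist x Ωᶜ)
    have hw0 := volume_ball_pos_rn x hr4
    have hwt := volume_ball_ne_top_rn x (1 / 4 * infDist x Ωᶜ)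
    have hwv := volume_ball_le_of_le_mul x x hr hr4 (by norm_num : (0 : ℝ) ≤ 2) (by linarith)
    rw [ENNReal.ofReal_ofNat] at hwv
    simp only [whitneyAvg]
    rw [ENNReal.div_le_iff hv0 hvt]
    refine hmain.trans ?_
    rw [mul_assoc, add_mul]
    gcongr C * (?_ + _)
    calc ∫⁻ y in ball x (1 / 4 * infDist x Ωᶜ), ‖ψ y‖ₑ ^ p
        = (∫⁻ y in ball x (1 / 4 * infDist x Ωᶜ), ‖ψ y‖ₑ ^ p) /
            volume (ball x (1 / 4 * infDist x Ωᶜ)) * volume (ball x (1 / 4 * infDist x Ωᶜ)) := by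
          rw [ENNReal.div_mul_cancel hw0 hwt]
      _ ≤ (∫⁻ y in ball x (1 / 4 * infDist x Ωᶜ), ‖ψ y‖ₑ ^ p) /
            volume (ball x (1 / 4 * infDist x Ωᶜ)) *
              (2 ^ n * volume (ball x (1 / 8 * infDist x Ωᶜ))) := by gcongr
      _ = _ := by ring
  calc ∫⁻ x in Ω, ‖ψ x‖ₑ ^ q
      ≤ 4 ^ n * ∫⁻ x in Ω, whitneyAvg Ω (1 / 8) (fun y => ‖ψ y‖ₑ ^ q) x :=
        setLIntegral_le_whitneyAvg hΩ hne (by norm_num) (by norm_num) (hm.pow_const q)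
    _ ≤ 4 ^ n * ∫⁻ x in Ω, C * (2 ^ n * whitneyAvg Ω (1 / 4) (fun y => ‖ψ y‖ₑ ^ p) x +
          whitneyAvg Ω (1 / 4) (fun y => ‖ψ y‖ₑ) x ^ q) :=
        mul_le_mul_right (setLIntegral_mono' hΩ.measurableSet hpt) _
    _ = 4 ^ n * (C * (2 ^ n * (∫⁻ x in Ω, whitneyAvg Ω (1 / 4) (fun y => ‖ψ y‖ₑ ^ p) x) +
          ∫⁻ x in Ω, whitneyAvg Ω (1 / 4) (fun y => ‖ψ y‖ₑ) x ^ q)) := by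
        rw [lintegral_const_mul' _ _ hC, lintegral_add_right _
          ((measurable_whitneyAvg Ω _ hm).pow_const q), lintegral_const_mul' _ _ h2t]
    _ ≤ 4 ^ n * (C * (2 ^ n * (4 ^ n * ∫⁻ x in Ω, ‖ψ x‖ₑ ^ p) + 2 ^ n * (4 ^ n *
          ∫⁻ x in Ω, whitneyAvg Ω (1 / 4) (fun y => ‖ψ y‖ₑ) x ^ q))) := by
        have h1 := setLIntegral_whitneyAvg_le hΩ hne (by norm_num : (0 : ℝ) < 1 / 4) (by norm_num)
          (hm.pow_const p)
        have h2 : ∀ t : ℝ≥0∞, t ≤ 2 ^ n * (4 ^ n * t) := fun t =>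
          (le_mul_of_one_le_left' h41).trans (le_mul_of_one_le_left' h21)
        exact mul_le_mul_right (mul_le_mul_right (add_le_add (mul_le_mul_right h1 _) (h2 _)) _) _
    _ = _ := by ring

/-- Functions on `Ω` that change by at most `c` between points at distance at most an eighth of the
distance to the complement of `Ω`. -/
def IsWhitneyLipschitz {n : ℕ} (Ω : Set (Rn n)) (c : ℝ≥0∞) (a : Rn n → ℝ≥0∞) : Prop :=
  ∀ x ∈ Ω, ∀ y ∈ Ω, dist x y ≤ infDist x Ωᶜ / 8 → a x ≤ a y + c ∧ a y ≤ a x + c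

theorem IsWhitneyLipschitz.exists_le_add {n : ℕ} {Ω : Set (Rn n)} (hΩ : IsOpen Ω)
    (hconn : IsPreconnected Ω) (hne : Ωᶜ.Nonempty) {c : ℝ≥0∞} (hc : c ≠ ⊤) {x₀ : Rn n}
    (hx₀ : x₀ ∈ Ω) {K : Set (Rn n)} (hK : IsCompact K) (hKΩ : K ⊆ Ω) :
    ∃ C : ℝ≥0∞, C ≠ ⊤ ∧ ∀ a, IsWhitneyLipschitz Ω c a → ∀ x ∈ K, a x ≤ a x₀ + C := by
  have hloc : ∀ x ∈ Ω, ∀ᶠ y in nhdsWithin x Ω, dist x y ≤ infDist x Ωᶜ / 8 := by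
    intro x hx
    have hpos : 0 < infDist x Ωᶜ / 8 := by
      have := infDist_compl_pos hΩ hne hx
      positivity
    filter_upwards [mem_nhdsWithin_of_mem_nhds (closedBall_mem_nhds x hpos)] with y hy
    rwa [dist_comm]
  have hchain : ∀ x ∈ Ω, ∃ C : ℝ≥0∞, C ≠ ⊤ ∧ ∀ a, IsWhitneyLipschitz Ω c a → a x ≤ a x₀ + C := by
    intro x hx
    refine hconn.induction₂' (fun x y => ∃ C : ℝ≥0∞, C ≠ ⊤ ∧
      ∀ a, IsWhitneyLipschitz Ω c a → a x ≤ a y + C) ?_ ?_ hx hx₀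
    · intro x hx
      filter_upwards [hloc x hx, self_mem_nhdsWithin] with y hy hyΩ
      exact ⟨⟨c, hc, fun a ha => (ha x hx y hyΩ hy).1⟩, ⟨c, hc, fun a ha => (ha x hx y hyΩ hy).2⟩⟩
    · rintro x y z - - - ⟨C, hC, h⟩ ⟨C', hC', h'⟩
      refine ⟨C' + C, ENNReal.add_ne_top.2 ⟨hC', hC⟩, fun a ha => (h a ha).trans ?_⟩
      rw [← add_assoc]
      gcongr
      exact h' a ha
  refine hK.induction_on (p := fun s => ∃ C : ℝ≥0∞, C ≠ ⊤ ∧ ∀ a, IsWhitneyLipschitz Ω c a →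
    ∀ x ∈ s, a x ≤ a x₀ + C) ?_ ?_ ?_ ?_
  · exact ⟨0, by simp, by simp⟩
  · rintro s t hst ⟨C, hC, h⟩
    exact ⟨C, hC, fun a ha x hx => h a ha x (hst hx)⟩
  · rintro s t ⟨C, hC, h⟩ ⟨C', hC', h'⟩
    refine ⟨C + C', ENNReal.add_ne_top.2 ⟨hC, hC'⟩, fun a ha x hx => ?_⟩
    rcases hx with hx | hx
    · exact (h a ha x hx).trans (add_le_add le_rfl le_self_add)
    · exact (h' a ha x hx).trans (add_le_add le_rfl le_add_self)
  · intro x hx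
    obtain ⟨C, hC, h⟩ := hchain x (hKΩ hx)
    refine ⟨_, Filter.inter_mem
      (nhdsWithin_mono _ hKΩ (hloc x (hKΩ hx))) self_mem_nhdsWithin,
      C + c, ENNReal.add_ne_top.2 ⟨hC, hc⟩, fun a ha y hy => ?_⟩
    refine ((ha x (hKΩ hx) y (hKΩ hy.2) hy.1).2).trans ?_
    rw [← add_assoc]
    gcongr
    exact h a ha

theorem IsUnitBMO.average_enorm_near {n : ℕ} {Ω : Set (Rn n)} {ψ : Rn n → ℝ}
    (H : IsUnitBMO Ω ψ) {c c' : Rn n} {r r' k : ℝ} (hr : 0 < r) (hr' : 0 < r')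
    (hc : closedBall c r ⊆ Ω) (hsub : ball c' r' ⊆ ball c r) (hk : 0 ≤ k) (hrk : r ≤ k * r') :
    (∫⁻ y in ball c' r', ‖ψ y‖ₑ) / volume (ball c' r') ≤
        ‖⨍ y in ball c r, ψ y‖ₑ + ENNReal.ofReal k ^ n ∧
      ‖⨍ y in ball c r, ψ y‖ₑ ≤
        (∫⁻ y in ball c' r', ‖ψ y‖ₑ) / volume (ball c' r') + ENNReal.ofReal k ^ n := by
  set m := ⨍ y in ball c r, ψ y with hm
  have hv0 := volume_ball_pos_rn c' hr'
  have hvt := volume_ball_ne_top_rn c' r'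
  have hosc : ∫⁻ x in ball c' r', ‖ψ x - m‖ₑ ≤ ENNReal.ofReal k ^ n * volume (ball c' r') :=
    (lintegral_mono_set hsub).trans ((H.osc c r hr hc).trans
      (volume_ball_le_of_le_mul c' c hr' hr hk hrk))
  have hmeas : Measurable fun x => ‖ψ x - m‖ₑ := (H.measurable.sub_const m).enorm
  constructor
  · rw [ENNReal.div_le_iff hv0 hvt]
    calc ∫⁻ y in ball c' r', ‖ψ y‖ₑ ≤ ∫⁻ y in ball c' r', (‖m‖ₑ + ‖ψ y - m‖ₑ) := by
          refine lintegral_mono fun y => ?_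
          have := enorm_add_le m (ψ y - m)
          rwa [add_sub_cancel] at this
      _ = ‖m‖ₑ * volume (ball c' r') + ∫⁻ y in ball c' r', ‖ψ y - m‖ₑ := by
          rw [lintegral_add_right _ hmeas, setLIntegral_const]
      _ ≤ _ := by
          rw [add_mul]
          gcongr
  · rw [← ENNReal.mul_le_mul_iff_left hv0 hvt, add_mul, ENNReal.div_mul_cancel hv0 hvt]
    calc ‖m‖ₑ * volume (ball c' r') = ∫⁻ y in ball c' r', ‖m‖ₑ := by rw [setLIntegral_const]
      _ ≤ ∫⁻ y in ball c' r', (‖ψ y‖ₑ + ‖ψ y - m‖ₑ) := by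
          refine lintegral_mono fun y => ?_
          have := enorm_sub_le (a := ψ y) (b := ψ y - m)
          rwa [sub_sub_cancel] at this
      _ ≤ _ := by
          rw [lintegral_add_right _ hmeas]
          gcongr

theorem IsUnitBMO.isWhitneyLipschitz {n : ℕ} {Ω : Set (Rn n)} {ψ : Rn n → ℝ} (hΩ : IsOpen Ω)
    (hne : Ωᶜ.Nonempty) (H : IsUnitBMO Ω ψ) :
    IsWhitneyLipschitz Ω (2 * 4 ^ n) (whitneyAvg Ω (1 / 4) fun y => ‖ψ y‖ₑ) := by
  intro x hx y hy hxy
  have hx0 := infDist_compl_pos hΩ hne hx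
  have hy0 := infDist_compl_pos hΩ hne hy
  have h1 := infDist_le_infDist_add_dist (s := Ωᶜ) (x := x) (y := y)
  have h2 := infDist_le_infDist_add_dist (s := Ωᶜ) (x := y) (y := x)
  rw [dist_comm y x] at h2
  have hball : closedBall x (infDist x Ωᶜ / 2) ⊆ Ω :=
    closedBall_subset_of_lt_infDist_compl (by linarith)
  obtain ⟨hxu, hxl⟩ := H.average_enorm_near (c' := x) (r' := 1 / 4 * infDist x Ωᶜ) (k := 4)
    (by linarith) (by linarith) hball (ball_subset_ball (by linarith)) (by norm_num) (by linarith)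
  obtain ⟨hyu, hyl⟩ := H.average_enorm_near (c' := y) (r' := 1 / 4 * infDist y Ωᶜ) (k := 4)
    (by linarith) (by linarith) hball (ball_subset_ball' (by rw [dist_comm]; linarith))
    (by norm_num) (by linarith)
  rw [ENNReal.ofReal_ofNat] at hxu hxl hyu hyl
  rw [two_mul, ← add_assoc, ← add_assoc]
  exact ⟨hxu.trans (add_le_add hyl le_rfl), hyu.trans (add_le_add hxl le_rfl)⟩

theorem IsUnitBMO.whitneyAvg_le {n : ℕ} {Ω : Set (Rn n)} {ψ : Rn n → ℝ} (hΩ : IsOpen Ω)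
    (hne : Ωᶜ.Nonempty) (H : IsUnitBMO Ω ψ) {x : Rn n} (hx : x ∈ Ω) :
    whitneyAvg Ω (1 / 4) (fun y => ‖ψ y‖ₑ) x ≤
      ‖⨍ y in ball x (1 / 4 * infDist x Ωᶜ), ψ y‖ₑ + 1 := by
  have hx0 := infDist_compl_pos hΩ hne hx
  have := (H.average_enorm_near (c' := x) (r' := 1 / 4 * infDist x Ωᶜ) (k := 1)
    (by linarith) (by linarith) (closedBall_subset_of_lt_infDist_compl (by linarith)) subset_rfl
    (by norm_num) (by linarith)).1
  rwa [ENNReal.ofReal_one, one_pow] at this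

theorem lintegral_eq_lintegral_slices {n : ℕ} {ν : Rn n} (hν : (∑ i, ν i * ν i) = 1)
    {g : Rn n → ℝ≥0∞} (hg : Measurable g) :
    ∫⁻ x, g x = ∫⁻ x, (Set.Icc (0 : ℝ) 1).indicator (fun _ => (1 : ℝ≥0∞)) (∑ i, x i * ν i) *
      ∫⁻ s : ℝ, g (x + s • ν) := by
  set e : ℝ → ℝ≥0∞ := (Set.Icc (0 : ℝ) 1).indicator (fun _ => (1 : ℝ≥0∞)) with he
  have hem : Measurable e := measurable_const.indicator measurableSet_Icc
  have hlm : Measurable fun x : Rn n => ∑ i, x i * ν i := by fun_prop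
  have hsum : ∀ (x : Rn n) (s : ℝ), ∑ i, (x + s • ν) i * ν i = (∑ i, x i * ν i) + s := by
    intro x s
    simp only [Pi.add_apply, Pi.smul_apply, smul_eq_mul, add_mul, Finset.sum_add_distrib,
      mul_assoc, ← Finset.mul_sum, hν, mul_one]
  have h1 : ∀ x : Rn n, e (∑ i, x i * ν i) * ∫⁻ s : ℝ, g (x + s • ν) =
      ∫⁻ s : ℝ, e (∑ i, x i * ν i) * g (x + s • ν) := by
    intro x
    rw [lintegral_const_mul]
    exact hg.comp (by fun_prop)
  simp only [h1]
  rw [lintegral_lintegral_swap]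
  · have h2 : ∀ s : ℝ, ∫⁻ x : Rn n, e (∑ i, x i * ν i) * g (x + s • ν) =
        ∫⁻ x : Rn n, e ((∑ i, x i * ν i) - s) * g x := by
      intro s
      rw [← lintegral_add_right_eq_self (fun x => e ((∑ i, x i * ν i) - s) * g x) (s • ν)]
      refine lintegral_congr fun x => ?_
      rw [hsum, add_sub_cancel_right]
    simp only [h2]
    rw [lintegral_lintegral_swap]
    · refine lintegral_congr fun x => ?_
      have h3 : Measurable fun s : ℝ => e ((∑ i, x i * ν i) - s) :=
        hem.comp (measurable_const.sub measurable_id)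
      rw [lintegral_mul_const _ h3,
        lintegral_sub_left_eq_self e, he, lintegral_indicator measurableSet_Icc]
      simp
    · refine Measurable.aemeasurable ?_
      exact (hem.comp ((hlm.comp measurable_snd).sub measurable_fst)).mul (hg.comp measurable_snd)
  · refine Measurable.aemeasurable ?_
    exact (hem.comp (hlm.comp measurable_fst)).mul
      (hg.comp (measurable_fst.add (measurable_snd.smul_const ν)))

theorem lintegral_comp_mul_add {g : ℝ → ℝ≥0∞} (hg : Measurable g) {a : ℝ} (ha : 0 < a) (b : ℝ) :
    ∫⁻ s, g (a * s + b) = ENNReal.ofReal a⁻¹ * ∫⁻ s, g s := by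
  have h1 : ∫⁻ s, g (s + b) = ∫⁻ s, g s := lintegral_add_right_eq_self g b
  have h2 : Measurable fun s => g (s + b) := hg.comp (measurable_add_const b)
  rw [← h1, ← smul_eq_mul, ← lintegral_smul_measure, ← abs_of_pos (inv_pos.2 ha),
    ← Real.map_volume_mul_left ha.ne', lintegral_map h2 (measurable_const_mul a)]

/-- Change of variables for the dilation by `1 + θ` away from a graph in the direction `ν`. -/
theorem lintegral_comp_graph_dilation {n : ℕ} {ν : Rn n} (hν : (∑ i, ν i * ν i) = 1)
    {f : Rn n → ℝ} (hf : Measurable f) (hfν : ∀ (y : Rn n) (t : ℝ), f (y + t • ν) = f y)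
    {θ : ℝ} (hθ : 0 < θ) {g : Rn n → ℝ≥0∞} (hg : Measurable g) :
    ∫⁻ x, g (x + (θ * ((∑ i, x i * ν i) - f x)) • ν) =
      ENNReal.ofReal (1 + θ)⁻¹ * ∫⁻ x, g x := by
  have hlm : Measurable fun x : Rn n => ∑ i, x i * ν i := by fun_prop
  have hsum : ∀ (x : Rn n) (s : ℝ), ∑ i, (x + s • ν) i * ν i = (∑ i, x i * ν i) + s := by
    intro x s
    simp only [Pi.add_apply, Pi.smul_apply, smul_eq_mul, add_mul, Finset.sum_add_distrib,
      mul_assoc, ← Finset.mul_sum, hν, mul_one]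
  have hΦ : Measurable fun x : Rn n => x + (θ * ((∑ i, x i * ν i) - f x)) • ν :=
    measurable_id.add (((hlm.sub hf).const_mul θ).smul_const ν)
  have hgΦ : Measurable fun x : Rn n => g (x + (θ * ((∑ i, x i * ν i) - f x)) • ν) := hg.comp hΦ
  rw [lintegral_eq_lintegral_slices hν hgΦ, lintegral_eq_lintegral_slices hν hg,
    ← lintegral_const_mul' _ _ ENNReal.ofReal_ne_top]
  refine lintegral_congr fun x => ?_
  rw [mul_left_comm]
  congr 1
  have hgx : Measurable fun s : ℝ => g (x + s • ν) :=
    hg.comp ((measurable_id.smul_const ν).const_add x)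
  rw [← lintegral_comp_mul_add hgx (by linarith : 0 < 1 + θ) (θ * ((∑ i, x i * ν i) - f x))]
  refine lintegral_congr fun s => ?_
  rw [hsum, hfν, add_assoc, ← add_smul]
  congr 3
  ring

/-- Near a boundary point of a Lipschitz domain there is a map which pushes points into the domain
by a small multiple of their distance to the boundary and expands volume by a fixed factor. -/
theorem IsLipschitzDomain.exists_expanding_map {n : ℕ} {Ω : Set (Rn n)} (hΩ : IsLipschitzDomain Ω)
    (hne : Ωᶜ.Nonempty) {x₀ : Rn n} (hx₀ : x₀ ∈ frontier Ω) :
    ∃ V ∈ nhds x₀, ∃ (K E : Set (Rn n)) (Φ : Rn n → Rn n) (γ : ℝ≥0∞), γ < 1 ∧ IsCompact K ∧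
      K ⊆ Ω ∧ MeasurableSet E ∧ E ⊆ Ω ∧ V ∩ Ω ⊆ E ∧ Measurable Φ ∧
      (∀ x ∈ E, Φ x ∈ E ∪ K ∧ dist x (Φ x) ≤ infDist x Ωᶜ / 8) ∧
      ∀ g : Rn n → ℝ≥0∞, Measurable g → ∫⁻ x, g (Φ x) = γ * ∫⁻ x, g x := by
  obtain ⟨hΩo, -, -, hch⟩ := hΩ
  obtain ⟨U, ν, f, k, hxU, hU, hν, hf, hfν, hΩU⟩ := hch x₀ hx₀
  obtain ⟨R, hR, hRU⟩ := Metric.isOpen_iff.1 hU x₀ hxU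
  obtain ⟨ℓ, hℓ⟩ : ∃ ℓ : Rn n → ℝ, ℓ = fun y => ∑ i, y i * ν i := ⟨_, rfl⟩
  obtain ⟨d, hd⟩ : ∃ d : Rn n → ℝ, d = fun y => ℓ y - f y := ⟨_, rfl⟩
  obtain ⟨P, hP⟩ : ∃ P : Rn n → Rn n, P = fun y => y + (-ℓ y) • ν := ⟨_, rfl⟩
  have hν1 : ∀ i, |ν i| ≤ 1 := by
    intro i
    have h1 : ν i * ν i ≤ ∑ i, ν i * ν i :=
      Finset.single_le_sum (f := fun i => ν i * ν i) (fun i _ => mul_self_nonneg _)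
        (Finset.mem_univ i)
    rw [hν] at h1
    rw [abs_le]
    constructor <;> nlinarith
  have hνn : ‖ν‖ ≤ 1 := (pi_norm_le_iff_of_nonneg zero_le_one).2 hν1
  have hℓc : Continuous ℓ := by rw [hℓ]; fun_prop
  have hdc : Continuous d := by rw [hd]; exact hℓc.sub hf.continuous
  have hPc : Continuous P := by
    rw [hP]
    exact continuous_id.add (hℓc.neg.smul continuous_const)
  have hℓadd : ∀ (y : Rn n) (t : ℝ), ℓ (y + t • ν) = ℓ y + t := by
    intro y t
    simp only [hℓ, Pi.add_apply, Pi.smul_apply, smul_eq_mul, add_mul, Finset.sum_add_distrib,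
      mul_assoc, ← Finset.mul_sum, hν, mul_one]
  have hdadd : ∀ (y : Rn n) (t : ℝ), d (y + t • ν) = d y + t := by
    intro y t
    simp only [hd, hℓadd, hfν]
    ring
  have hPadd : ∀ (y : Rn n) (t : ℝ), P (y + t • ν) = P y := by
    intro y t
    simp only [hP, hℓadd]
    module
  have hdL : ∀ y z, d y - d z ≤ (n + k) * dist y z := by
    intro y z
    have h1 : ℓ y - ℓ z ≤ n * dist y z := by
      simp only [hℓ]
      rw [← Finset.sum_sub_distrib]
      calc ∑ i, (y i * ν i - z i * ν i) ≤ ∑ _i : Fin n, dist y z := by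
            refine Finset.sum_le_sum fun i _ => ?_
            have h2 := dist_le_pi_dist y z i
            rw [Real.dist_eq] at h2
            rw [← sub_mul]
            calc (y i - z i) * ν i ≤ |(y i - z i) * ν i| := le_abs_self _
              _ = |y i - z i| * |ν i| := abs_mul _ _
              _ ≤ dist y z * 1 := mul_le_mul h2 (hν1 i) (abs_nonneg _) dist_nonneg
              _ = _ := mul_one _
        _ = _ := by simp
    have h2 := hf.dist_le_mul y z
    rw [Real.dist_eq] at h2
    have h3 := neg_abs_le (f y - f z)
    simp only [hd]
    linarith
  have hΩd : ∀ y ∈ U, (y ∈ Ω ↔ 0 < d y) := by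
    intro y hy
    have : y ∈ Ω ∩ U ↔ y ∈ {y ∈ U | f y < ∑ i, y i * ν i} := by rw [hΩU]
    simp only [Set.mem_inter_iff, hy, and_true, Set.mem_ofPred_eq, true_and] at this
    rw [this]
    simp only [hd, hℓ, sub_pos]
  have hd0 : d x₀ = 0 := by
    rw [hΩo.frontier_eq] at hx₀
    refine le_antisymm (not_lt.1 fun h => hx₀.2 ((hΩd x₀ hxU).2 h)) (not_lt.1 fun h => ?_)
    obtain ⟨z, ⟨hz1, hzU⟩, hzΩ⟩ := mem_closure_iff.1 hx₀.1 ({y | d y < 0} ∩ U)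
      ((isOpen_lt hdc continuous_const).inter hU) ⟨h, hxU⟩
    exact absurd hz1 (not_lt.2 ((hΩd z hzU).1 hzΩ).le)
  have hk0 : (0 : ℝ) ≤ k := k.2
  obtain ⟨ρ, hρ⟩ : ∃ ρ : ℝ, ρ = R / (2 * (3 + k)) := ⟨_, rfl⟩
  have hρ0 : 0 < ρ := by rw [hρ]; positivity
  have hρR : (3 + k) * ρ = R / 2 := by
    rw [hρ]
    field_simp
  have hnear : ∀ y, dist (P y) (P x₀) ≤ ρ → |d y| ≤ 2 * ρ → dist y x₀ ≤ R / 2 := by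
    intro y h1 h2
    have h3 : y - x₀ = (P y - P x₀) + (ℓ y - ℓ x₀) • ν := by
      simp only [hP]
      module
    have h4 : ℓ y - ℓ x₀ = d y + (f (P y) - f (P x₀)) := by
      have e1 : f (P y) = f y := by simp only [hP, hfν]
      have e2 : f (P x₀) = f x₀ := by simp only [hP, hfν]
      have e3 : ℓ x₀ - f x₀ = 0 := by rw [← hd0, hd]
      rw [e1, e2]
      simp only [hd]
      linarith
    have h5 := hf.dist_le_mul (P y) (P x₀)
    rw [Real.dist_eq] at h5
    have h6 : |ℓ y - ℓ x₀| ≤ 2 * ρ + k * ρ := by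
      rw [h4]
      refine (abs_add_le _ _).trans (add_le_add h2 (h5.trans ?_))
      gcongr
    rw [dist_eq_norm, h3]
    calc ‖(P y - P x₀) + (ℓ y - ℓ x₀) • ν‖ ≤ ‖P y - P x₀‖ + |ℓ y - ℓ x₀| * ‖ν‖ := by
          refine (norm_add_le _ _).trans (le_of_eq ?_)
          rw [norm_smul, Real.norm_eq_abs]
      _ ≤ ρ + (2 * ρ + k * ρ) * 1 := by
          rw [← dist_eq_norm]
          refine add_le_add h1 (mul_le_mul h6 hνn (norm_nonneg _) (by positivity))
      _ = R / 2 := by rw [← hρR]; ring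
  have hnearU : ∀ y, dist (P y) (P x₀) ≤ ρ → |d y| ≤ 2 * ρ → y ∈ U := fun y h1 h2 =>
    hRU (mem_ball.2 (by linarith [hnear y h1 h2]))
  obtain ⟨L, hL⟩ : ∃ L : ℝ, L = n + k + 1 := ⟨_, rfl⟩
  have hL1 : 1 ≤ L := by
    have : (0 : ℝ) ≤ n := n.cast_nonneg
    linarith
  have hL0 : 0 < L := by linarith
  have hinf : ∀ y, dist (P y) (P x₀) ≤ ρ → 0 < d y → d y ≤ 2 * ρ → d y / L ≤ infDist y Ωᶜ := by
    intro y h1 h0 h2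
    refine (le_infDist hne).2 fun z hz => not_lt.1 fun hyz => hz ?_
    have h3 := hnear y h1 (abs_le.2 ⟨by linarith, h2⟩)
    have h4 : d y / L ≤ R / 2 := by
      refine (div_le_self h0.le hL1).trans (h2.trans ?_)
      rw [← hρR]
      nlinarith
    have hzU : z ∈ U := hRU (mem_ball.2 (by
      have := dist_triangle z y x₀
      rw [dist_comm z y] at this
      linarith))
    rw [hΩd z hzU]
    have h5 := hdL y z
    rw [lt_div_iff₀ hL0] at hyz
    have h6 := dist_nonneg (x := y) (y := z)
    have h7 : dist y z * L = (n + k) * dist y z + dist y z := by rw [hL]; ring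
    linarith
  obtain ⟨θ, hθ⟩ : ∃ θ : ℝ, θ = 1 / (8 * L) := ⟨_, rfl⟩
  have hθ0 : 0 < θ := by rw [hθ]; positivity
  have hθ8 : θ ≤ 1 / 8 := by
    rw [hθ]
    gcongr
    linarith
  refine ⟨{y | dist (P y) (P x₀) < ρ ∧ |d y| < ρ}, ?_,
    {y | dist (P y) (P x₀) ≤ ρ ∧ ρ ≤ d y ∧ d y ≤ 3 / 2 * ρ},
    {y | dist (P y) (P x₀) < ρ ∧ 0 < d y ∧ d y < ρ}, fun y => y + (θ * d y) • ν,
    ENNReal.ofReal (1 + θ)⁻¹, ?_, ?_, ?_, ?_, ?_, ?_, ?_, ?_, ?_⟩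
  · refine IsOpen.mem_nhds ?_ ⟨?_, ?_⟩
    · exact (isOpen_lt (hPc.dist continuous_const) continuous_const).inter
        (isOpen_lt hdc.abs continuous_const)
    · rwa [dist_self]
    · rwa [hd0, abs_zero]
  · rw [ENNReal.ofReal_lt_one]
    exact inv_lt_one_of_one_lt₀ (by linarith)
  · refine Metric.isCompact_of_isClosed_isBounded ?_ ?_
    · exact (isClosed_le (hPc.dist continuous_const) continuous_const).inter
        ((isClosed_le continuous_const hdc).inter (isClosed_le hdc continuous_const))
    · refine (isBounded_closedBall (x := x₀) (r := R / 2)).subset fun y hy => ?_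
      exact hnear y hy.1 (abs_le.2 ⟨by linarith [hy.2.1], by linarith [hy.2.2]⟩)
  · intro y hy
    exact (hΩd y (hnearU y hy.1 (abs_le.2 ⟨by linarith [hy.2.1], by linarith [hy.2.2]⟩))).2
      (by linarith [hy.2.1])
  · exact ((isOpen_lt (hPc.dist continuous_const) continuous_const).inter
      ((isOpen_lt continuous_const hdc).inter (isOpen_lt hdc continuous_const))).measurableSet
  · intro y hy
    exact (hΩd y (hnearU y hy.1.le (abs_le.2 ⟨by linarith [hy.2.1], by linarith [hy.2.2]⟩))).2
      hy.2.1
  · rintro y ⟨⟨h1, h2⟩, hyΩ⟩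
    exact ⟨h1, (hΩd y (hnearU y h1.le (by linarith))).1 hyΩ, (abs_lt.1 h2).2⟩
  · exact (continuous_id.add ((continuous_const.mul hdc).smul continuous_const)).measurable
  · rintro y ⟨h1, h2, h3⟩
    constructor
    · have h4 : d (y + (θ * d y) • ν) = (1 + θ) * d y := by rw [hdadd]; ring
      rcases lt_or_ge ((1 + θ) * d y) ρ with h | h
      · left
        refine ⟨?_, ?_, ?_⟩
        · rwa [hPadd]
        · rw [h4]; positivity
        · rwa [h4]
      · right
        refine ⟨?_, ?_, ?_⟩
        · rw [hPadd]; exact h1.le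
        · rwa [h4]
        · rw [h4]; nlinarith
    · have h4 := hinf y h1.le h2 (by linarith)
      rw [dist_eq_norm, sub_add_cancel_left, norm_neg, norm_smul, Real.norm_eq_abs,
        abs_of_pos (by positivity)]
      have h5 : θ * d y = d y / L / 8 := by
        rw [hθ]
        field_simp
      have h6 : θ * d y * ‖ν‖ ≤ θ * d y := mul_le_of_le_one_right (by positivity) hνn
      linarith
  · intro g hg
    simp only [hd, hℓ]
    exact lintegral_comp_graph_dilation hν hf.continuous.measurable hfν hθ0 hg

theorem ENNReal.rpow_le_rpow_sub_mul_rpow {x M : ℝ≥0∞} (h : x ≤ M) {p q : ℝ} (hp : 0 ≤ p)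
    (hpq : p ≤ q) : x ^ q ≤ M ^ (q - p) * x ^ p := by
  have hqp : 0 ≤ q - p := by linarith
  calc x ^ q = x ^ (q - p) * x ^ p := by
        rw [← ENNReal.rpow_add_of_nonneg _ _ hqp hp, sub_add_cancel]
    _ ≤ M ^ (q - p) * x ^ p := by gcongr

theorem ENNReal.exists_one_lt_rpow_mul_lt_one {γ : ℝ≥0∞} (hγ : γ < 1) {q : ℝ} (hq : 0 < q) :
    ∃ κ : ℝ≥0∞, 1 < κ ∧ κ ≠ ⊤ ∧ κ ^ q * γ < 1 := by
  obtain ⟨γ', h1, h2⟩ := exists_between (max_lt hγ ENNReal.one_half_lt_one)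
  have h0 : γ' ≠ 0 := (pos_of_gt h1).ne'
  have ht : γ' ≠ ⊤ := (h2.trans one_lt_top).ne
  refine ⟨γ' ^ (-1 / q), ?_, rpow_ne_top_of_ne_zero h0 ht, ?_⟩
  · exact one_lt_rpow_of_pos_of_lt_one_of_neg (pos_of_gt h1) h2 (div_neg_of_neg_of_pos (by norm_num) hq)
  · rw [← rpow_mul, div_mul_cancel₀ _ hq.ne', rpow_neg_one]
    calc γ'⁻¹ * γ < γ'⁻¹ * γ' :=
          (ENNReal.mul_lt_mul_iff_right (ENNReal.inv_ne_zero.2 ht) (ENNReal.inv_ne_top.2 h0)).2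
            ((le_max_left _ _).trans_lt h1)
      _ = 1 := ENNReal.inv_mul_cancel h0 ht

/-- If `a x ≤ a (Φ x) + c` for a volume-expanding map `Φ`, then large values of `a` on `E` can be
absorbed. -/
theorem exists_setLIntegral_rpow_le_of_expanding {α : Type*} [MeasurableSpace α] {μ : Measure α}
    {γ c Λ : ℝ≥0∞} (hγ : γ < 1) (hc : c ≠ ⊤) (hΛ : Λ ≠ ⊤) {p q : ℝ} (hp : 0 ≤ p) (hpq : p ≤ q)
    (hq : 0 < q) {E K : Set α} (hE : MeasurableSet E) (hEfin : μ E ≠ ⊤) {Φ : α → α}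
    (hΦ : ∀ x ∈ E, Φ x ∈ E ∪ K) (hΦint : ∀ g : α → ℝ≥0∞, Measurable g →
      ∫⁻ x, g (Φ x) ∂μ = γ * ∫⁻ x, g x ∂μ) :
    ∃ C : ℝ≥0∞, C ≠ ⊤ ∧ ∀ a : α → ℝ≥0∞, Measurable a → (∀ x ∈ E, a x ≤ a (Φ x) + c) →
      (∀ x ∈ K, a x ≤ Λ) → ∫⁻ x in E, a x ^ q ∂μ ≤ C * ∫⁻ x in E, a x ^ p ∂μ := by
  obtain ⟨κ, hκ1, hκt, hκγ⟩ := ENNReal.exists_one_lt_rpow_mul_lt_one hγ hq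
  have hκ0 : κ - 1 ≠ 0 := (tsub_pos_of_lt hκ1).ne'
  have hκ1t : κ - 1 ≠ ⊤ := ENNReal.sub_ne_top hκt
  obtain ⟨M, hM⟩ : ∃ M : ℝ≥0∞, M = max Λ (c / (κ - 1)) := ⟨_, rfl⟩
  have hMt : M ≠ ⊤ := by
    rw [hM]
    exact (max_lt hΛ.lt_top (ENNReal.div_lt_top hc hκ0)).ne
  have hMc : c ≤ (κ - 1) * M := by
    rw [hM, mul_comm, ← ENNReal.div_le_iff hκ0 hκ1t]
    exact le_max_right _ _
  have hqp : 0 ≤ q - p := by linarith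
  have hDt : (M + c) ^ (q - p) ≠ ⊤ :=
    ENNReal.rpow_ne_top_of_nonneg hqp (ENNReal.add_ne_top.2 ⟨hMt, hc⟩)
  have h1γ : 1 - κ ^ q * γ ≠ 0 := (tsub_pos_of_lt hκγ).ne'
  refine ⟨(1 - κ ^ q * γ)⁻¹ * (M + c) ^ (q - p), ENNReal.mul_ne_top
    (ENNReal.inv_ne_top.2 h1γ) hDt, fun a ha haΦ haK => ?_⟩
  refine lintegral_rpow_le_of_forall_min ha hq.le fun N => ?_
  have hmin : Measurable fun x => min (a x) (N : ℝ≥0∞) ^ q := (ha.min measurable_const).pow_const q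
  obtain ⟨I, hI⟩ : ∃ I, I = ∫⁻ x in E, min (a x) (N : ℝ≥0∞) ^ q ∂μ := ⟨_, rfl⟩
  have hIt : I ≠ ⊤ := by
    rw [hI]
    refine ne_top_of_le_ne_top (ENNReal.mul_ne_top (ENNReal.rpow_ne_top_of_nonneg hq.le
      (ENNReal.natCast_ne_top N)) hEfin) ((lintegral_mono fun x => ?_).trans_eq
      (setLIntegral_const E ((N : ℝ≥0∞) ^ q)))
    exact ENNReal.rpow_le_rpow (min_le_right _ _) hq.le
  have hpt : ∀ x ∈ E, min (a x) (N : ℝ≥0∞) ^ q ≤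
      κ ^ q * E.indicator (fun y => min (a y) (N : ℝ≥0∞) ^ q) (Φ x) +
        (M + c) ^ (q - p) * a x ^ p := by
    intro x hx
    rcases le_or_gt (a x) (M + c) with h | h
    · refine le_add_left ((ENNReal.rpow_le_rpow (min_le_left _ _) hq.le).trans ?_)
      exact ENNReal.rpow_le_rpow_sub_mul_rpow h hp hpq
    · have hΦM : M < a (Φ x) := lt_of_add_lt_add_right (h.trans_le (haΦ x hx))
      have hΦE : Φ x ∈ E := (hΦ x hx).resolve_right fun hK =>
        absurd (haK _ hK) (not_le.2 ((le_max_left Λ _).trans_lt (hM ▸ hΦM)))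
      refine le_add_right ?_
      rw [Set.indicator_of_mem hΦE, ← ENNReal.mul_rpow_of_nonneg _ _ hq.le]
      refine ENNReal.rpow_le_rpow ?_ hq.le
      have h1 : a x ≤ κ * a (Φ x) := by
        have h2 := hMc.trans (mul_le_mul_right hΦM.le (κ - 1))
        calc a x ≤ a (Φ x) + (κ - 1) * a (Φ x) := (haΦ x hx).trans (add_le_add le_rfl h2)
          _ = (1 + (κ - 1)) * a (Φ x) := by ring
          _ = _ := by rw [add_tsub_cancel_of_le hκ1.le]
      rcases le_total (a (Φ x)) N with h2 | h2
      · rw [min_eq_left h2]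
        exact (min_le_left _ _).trans h1
      · rw [min_eq_right h2]
        exact (min_le_right _ _).trans (le_mul_of_one_le_left' hκ1.le)
  have hmain : I ≤ κ ^ q * γ * I + (M + c) ^ (q - p) * ∫⁻ x in E, a x ^ p ∂μ := by
    calc I ≤ ∫⁻ x in E, (κ ^ q * E.indicator (fun y => min (a y) (N : ℝ≥0∞) ^ q) (Φ x) +
          (M + c) ^ (q - p) * a x ^ p) ∂μ := by
          rw [hI]
          exact setLIntegral_mono' hE hpt
      _ = (∫⁻ x in E, κ ^ q * E.indicator (fun y => min (a y) (N : ℝ≥0∞) ^ q) (Φ x) ∂μ) +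
          (M + c) ^ (q - p) * ∫⁻ x in E, a x ^ p ∂μ := by
          rw [lintegral_add_right _ ((ha.pow_const p).const_mul _), lintegral_const_mul' _ _ hDt]
      _ ≤ (∫⁻ x, κ ^ q * E.indicator (fun y => min (a y) (N : ℝ≥0∞) ^ q) (Φ x) ∂μ) +
          (M + c) ^ (q - p) * ∫⁻ x in E, a x ^ p ∂μ := by
          exact add_le_add (setLIntegral_le_lintegral _ _) le_rfl
      _ = _ := by
          rw [lintegral_const_mul' _ _ (ENNReal.rpow_ne_top_of_nonneg hq.le hκt),
            hΦint _ (hmin.indicator hE), lintegral_indicator hE, ← hI, mul_assoc]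
  rw [← hI, mul_assoc, mul_comm, ← div_eq_mul_inv, ENNReal.le_div_iff_mul_le (Or.inl h1γ)
    (Or.inl (ENNReal.sub_ne_top ENNReal.one_ne_top)), ENNReal.mul_sub (fun _ _ => hIt), mul_one,
    tsub_le_iff_left, mul_comm I]
  exact hmain

theorem IsLipschitzDomain.exists_isCompact_setLIntegral_rpow_le {n : ℕ} {Ω : Set (Rn n)}
    (hΩ : IsLipschitzDomain Ω) (hne : Ωᶜ.Nonempty) {c : ℝ≥0∞} (hc : c ≠ ⊤) {p q : ℝ} (hp : 0 ≤ p)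
    (hpq : p ≤ q) (hq : 0 < q) :
    ∃ K : Set (Rn n), IsCompact K ∧ K ⊆ Ω ∧ ∀ Λ : ℝ≥0∞, Λ ≠ ⊤ → ∃ C : ℝ≥0∞, C ≠ ⊤ ∧
      ∀ a : Rn n → ℝ≥0∞, Measurable a → IsWhitneyLipschitz Ω c a → (∀ x ∈ K, a x ≤ Λ) →
        ∫⁻ x in Ω, a x ^ q ≤ C * ∫⁻ x in Ω, a x ^ p := by
  have hΩo := hΩ.1
  have hcl : IsCompact (closure Ω) := hΩ.2.2.1.isCompact_closure
  suffices h : ∃ K : Set (Rn n), IsCompact K ∧ K ⊆ Ω ∧ ∀ Λ : ℝ≥0∞, Λ ≠ ⊤ → ∃ C : ℝ≥0∞, C ≠ ⊤ ∧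
      ∀ a : Rn n → ℝ≥0∞, Measurable a → IsWhitneyLipschitz Ω c a → (∀ x ∈ K, a x ≤ Λ) →
        ∫⁻ x in closure Ω ∩ Ω, a x ^ q ≤ C * ∫⁻ x in Ω, a x ^ p by
    rwa [Set.inter_eq_right.2 subset_closure] at h
  refine hcl.induction_on
    (p := fun s => ∃ K : Set (Rn n), IsCompact K ∧ K ⊆ Ω ∧ ∀ Λ : ℝ≥0∞, Λ ≠ ⊤ → ∃ C : ℝ≥0∞, C ≠ ⊤ ∧
      ∀ a : Rn n → ℝ≥0∞, Measurable a → IsWhitneyLipschitz Ω c a → (∀ x ∈ K, a x ≤ Λ) →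
        ∫⁻ x in s ∩ Ω, a x ^ q ≤ C * ∫⁻ x in Ω, a x ^ p) ?_ ?_ ?_ ?_
  · exact ⟨∅, isCompact_empty, Set.empty_subset _, fun Λ _ => ⟨0, ENNReal.zero_ne_top, by simp⟩⟩
  · rintro s t hst ⟨K, hK, hKΩ, h⟩
    refine ⟨K, hK, hKΩ, fun Λ hΛ => ?_⟩
    obtain ⟨C, hC, h⟩ := h Λ hΛ
    exact ⟨C, hC, fun a ha hal haK =>
      (lintegral_mono_set (Set.inter_subset_inter_left _ hst)).trans (h a ha hal haK)⟩
  · rintro s t ⟨K, hK, hKΩ, h⟩ ⟨K', hK', hKΩ', h'⟩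
    refine ⟨K ∪ K', hK.union hK', Set.union_subset hKΩ hKΩ', fun Λ hΛ => ?_⟩
    obtain ⟨C, hC, h⟩ := h Λ hΛ
    obtain ⟨C', hC', h'⟩ := h' Λ hΛ
    refine ⟨C + C', ENNReal.add_ne_top.2 ⟨hC, hC'⟩, fun a ha hal haK => ?_⟩
    rw [Set.union_inter_distrib_right, add_mul]
    exact (lintegral_union_le _ _ _).trans (add_le_add
      (h a ha hal fun x hx => haK x (Or.inl hx)) (h' a ha hal fun x hx => haK x (Or.inr hx)))
  · intro x hx
    by_cases hxΩ : x ∈ Ω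
    · have hx0 := infDist_compl_pos hΩo hne hxΩ
      have hsub : closedBall x (infDist x Ωᶜ / 2) ⊆ Ω :=
        closedBall_subset_of_lt_infDist_compl (by linarith)
      refine ⟨closedBall x (infDist x Ωᶜ / 2),
        mem_nhdsWithin_of_mem_nhds (closedBall_mem_nhds x (by linarith)),
        closedBall x (infDist x Ωᶜ / 2), isCompact_closedBall _ _, hsub, fun Λ hΛ =>
        ⟨Λ ^ (q - p), ENNReal.rpow_ne_top_of_nonneg (by linarith) hΛ, fun a ha _ haK => ?_⟩⟩
      rw [Set.inter_eq_left.2 hsub]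
      calc ∫⁻ y in closedBall x (infDist x Ωᶜ / 2), a y ^ q
          ≤ ∫⁻ y in closedBall x (infDist x Ωᶜ / 2), Λ ^ (q - p) * a y ^ p :=
            setLIntegral_mono' measurableSet_closedBall fun y hy =>
              ENNReal.rpow_le_rpow_sub_mul_rpow (haK y hy) hp hpq
        _ ≤ ∫⁻ y in Ω, Λ ^ (q - p) * a y ^ p := lintegral_mono_set hsub
        _ = _ := lintegral_const_mul _ (ha.pow_const p)
    · have hfr : x ∈ frontier Ω := by
        rw [hΩo.frontier_eq]
        exact ⟨hx, hxΩ⟩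
      obtain ⟨V, hV, K, E, Φ, γ, hγ, hK, hKΩ, hE, hEΩ, hVE, -, hΦ, hψint⟩ :=
        hΩ.exists_expanding_map hne hfr
      have hEfin : volume E ≠ ⊤ := (hΩ.2.2.1.subset hEΩ).measure_lt_top.ne
      refine ⟨V, mem_nhdsWithin_of_mem_nhds hV, K, hK, hKΩ, fun Λ hΛ => ?_⟩
      obtain ⟨C, hC, h⟩ := exists_setLIntegral_rpow_le_of_expanding hγ hc hΛ hp hpq hq hE hEfin
        (fun x hx => (hΦ x hx).1) hψint
      refine ⟨C, hC, fun a ha hal haK => (lintegral_mono_set hVE).trans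
        ((h a ha (fun y hy => ?_) haK).trans (mul_le_mul_right (lintegral_mono_set hEΩ) _))⟩
      have hΦΩ : Φ y ∈ Ω := Set.union_subset hEΩ hKΩ (hΦ y hy).1
      exact (hal y (hEΩ hy) _ hΦΩ (hΦ y hy).2).1

theorem IsLipschitzDomain.exists_setLIntegral_rpow_le {n : ℕ} {Ω : Set (Rn n)}
    (hΩ : IsLipschitzDomain Ω) (hne : Ωᶜ.Nonempty) {c : ℝ≥0∞} (hc : c ≠ ⊤) {p q : ℝ} (hp : 0 ≤ p)
    (hpq : p ≤ q) (hq : 0 < q) {x₀ : Rn n} (hx₀ : x₀ ∈ Ω) {Λ : ℝ≥0∞} (hΛ : Λ ≠ ⊤) :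
    ∃ C : ℝ≥0∞, C ≠ ⊤ ∧ ∀ a : Rn n → ℝ≥0∞, Measurable a → IsWhitneyLipschitz Ω c a → a x₀ ≤ Λ →
      ∫⁻ x in Ω, a x ^ q ≤ C * ∫⁻ x in Ω, a x ^ p := by
  obtain ⟨K, hK, hKΩ, h⟩ := hΩ.exists_isCompact_setLIntegral_rpow_le hne hc hp hpq hq
  obtain ⟨C', hC', h'⟩ := IsWhitneyLipschitz.exists_le_add hΩ.1 hΩ.2.1.isPreconnected hne hc hx₀ hK
    hKΩ
  obtain ⟨C, hC, h⟩ := h (Λ + C') (ENNReal.add_ne_top.2 ⟨hΛ, hC'⟩)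
  exact ⟨C, hC, fun a ha hal ha0 => h a ha hal fun x hx => (h' a hal x hx).trans (by gcongr)⟩

/-- Interpolation for functions of unit mean oscillation whose average over a fixed cube is
bounded. -/
theorem IsLipschitzDomain.exists_isUnitBMO_rpow_le {n : ℕ} {Ω : Set (Rn n)}
    (hΩ : IsLipschitzDomain Ω) (hne : Ωᶜ.Nonempty) {p q : ℝ} (hp : 1 ≤ p) (hpq : p ≤ q)
    {x₀ : Rn n} (hx₀ : x₀ ∈ Ω) {Λ : ℝ≥0∞} (hΛ : Λ ≠ ⊤) :
    ∃ C : ℝ≥0∞, C ≠ ⊤ ∧ ∀ ψ : Rn n → ℝ, IsUnitBMO Ω ψ →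
      ‖⨍ y in ball x₀ (1 / 4 * infDist x₀ Ωᶜ), ψ y‖ₑ ≤ Λ →
        ∫⁻ x in Ω, ‖ψ x‖ₑ ^ q ≤ C * ∫⁻ x in Ω, ‖ψ x‖ₑ ^ p := by
  have h4t : (4 : ℝ≥0∞) ^ n ≠ ⊤ := ENNReal.pow_ne_top (by norm_num)
  obtain ⟨C, hC, h⟩ := exists_setLIntegral_rpow_le_whitneyAvg n hp hpq
  obtain ⟨C', hC', h'⟩ := hΩ.exists_setLIntegral_rpow_le hne (c := 2 * 4 ^ n)
    (ENNReal.mul_ne_top (by norm_num) h4t) (by linarith) hpq (by linarith) hx₀ (Λ := Λ + 1)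
    (ENNReal.add_ne_top.2 ⟨hΛ, ENNReal.one_ne_top⟩)
  refine ⟨C * (1 + C' * 4 ^ n), ENNReal.mul_ne_top hC (ENNReal.add_ne_top.2 ⟨ENNReal.one_ne_top,
    ENNReal.mul_ne_top hC' h4t⟩), fun ψ H hψ => ?_⟩
  have hm := H.measurable.enorm
  refine (h Ω ψ hΩ.1 hne H).trans ?_
  have h1 := h' _ (measurable_whitneyAvg Ω (1 / 4) hm) (H.isWhitneyLipschitz hΩ.1 hne)
    ((H.whitneyAvg_le hΩ.1 hne hx₀).trans (by gcongr))
  rw [mul_assoc, add_mul, one_mul]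
  gcongr C * (_ + ?_)
  refine h1.trans ?_
  rw [mul_assoc]
  gcongr C' * ?_
  exact (setLIntegral_mono' hΩ.1.measurableSet fun x hx =>
    whitneyAvg_rpow_le hΩ.1 hne (by norm_num) hm hp hx).trans
    (setLIntegral_whitneyAvg_le hΩ.1 hne (by norm_num) (by norm_num) (hm.pow_const p))

theorem IsLipschitzDomain.exists_isUnitBMO_lintegral_le {n : ℕ} {Ω : Set (Rn n)}
    (hΩ : IsLipschitzDomain Ω) (hne : Ωᶜ.Nonempty) {x₀ : Rn n} (hx₀ : x₀ ∈ Ω) {Λ : ℝ≥0∞}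
    (hΛ : Λ ≠ ⊤) :
    ∃ C : ℝ≥0∞, C ≠ ⊤ ∧ ∀ ψ : Rn n → ℝ, IsUnitBMO Ω ψ →
      ‖⨍ y in ball x₀ (1 / 4 * infDist x₀ Ωᶜ), ψ y‖ₑ ≤ Λ →
        ∫⁻ x in Ω, ‖ψ x‖ₑ ≤ C * volume Ω := by
  have h4t : (4 : ℝ≥0∞) ^ n ≠ ⊤ := ENNReal.pow_ne_top (by norm_num)
  obtain ⟨C, hC, h⟩ := hΩ.exists_setLIntegral_rpow_le hne (c := 2 * 4 ^ n) (p := 0) (q := 1)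
    (ENNReal.mul_ne_top (by norm_num) h4t) le_rfl zero_le_one one_pos hx₀ (Λ := Λ + 1)
    (ENNReal.add_ne_top.2 ⟨hΛ, ENNReal.one_ne_top⟩)
  refine ⟨4 ^ n * C, ENNReal.mul_ne_top h4t hC, fun ψ H hψ => ?_⟩
  have hm := H.measurable.enorm
  have h1 := h _ (measurable_whitneyAvg Ω (1 / 4) hm) (H.isWhitneyLipschitz hΩ.1 hne)
    ((H.whitneyAvg_le hΩ.1 hne hx₀).trans (by gcongr))
  simp only [ENNReal.rpow_one, ENNReal.rpow_zero, setLIntegral_one] at h1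
  rw [mul_assoc]
  exact (setLIntegral_le_whitneyAvg hΩ.1 hne (by norm_num : (0 : ℝ) < 1 / 4) (by norm_num)
    hm).trans (by gcongr)

theorem setAverage_const_mul {α : Type*} [MeasurableSpace α] {μ : Measure α} (s : Set α)
    (b : ℝ) (ψ : α → ℝ) : ⨍ x in s, b * ψ x ∂μ = b * ⨍ x in s, ψ x ∂μ := by
  rw [setAverage_eq, setAverage_eq, integral_const_mul, smul_eq_mul, smul_eq_mul, mul_left_comm]

theorem isUnitBMO_of_bmo_le {n : ℕ} {Ω : Set (Rn n)} {ψ : Rn n → ℝ} (hψ : Measurable ψ)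
    (hψint : ∀ c r, 0 < r → closedBall c r ⊆ Ω → IntegrableOn ψ (ball c r)) {b : ℝ} (hb : 0 < b)
    (hbmo : bmo Ω ψ ≤ ENNReal.ofReal b) : IsUnitBMO Ω fun x => b⁻¹ * ψ x := by
  refine ⟨hψ.const_mul _, fun c r hr hc => (hψint c r hr hc).const_mul _, fun c r hr hc => ?_⟩
  have hmo : mo (ball c r) ψ ≤ ENNReal.ofReal b :=
    (le_iSup₂ (f := fun Q (_ : IsCubeIn Ω Q) => mo Q ψ) (ball c r)
      ⟨⟨c, r, hr, rfl⟩, (closure_ball_subset_closedBall).trans hc⟩).trans hbmo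
  rw [mo, ENNReal.div_le_iff (volume_ball_pos_rn c hr) (volume_ball_ne_top_rn c r)] at hmo
  rw [setAverage_const_mul]
  simp only [← mul_sub, enorm_mul]
  rw [lintegral_const_mul' _ _ enorm_ne_top]
  refine (mul_le_mul_right hmo _).trans (le_of_eq ?_)
  rw [← mul_assoc, Real.enorm_of_nonneg (inv_nonneg.2 hb.le),
    ← ENNReal.ofReal_mul (inv_nonneg.2 hb.le), inv_mul_cancel₀ hb.ne', ENNReal.ofReal_one, one_mul]

theorem setAverage_sub_const {α : Type*} [MeasurableSpace α] {μ : Measure α} {s : Set α}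
    {ψ : α → ℝ} (hψ : IntegrableOn ψ s μ) (hs0 : μ s ≠ 0) (hs : μ s ≠ ⊤) (k : ℝ) :
    ⨍ x in s, (ψ x - k) ∂μ = (⨍ x in s, ψ x ∂μ) - k := by
  have h : μ.real s ≠ 0 := (ENNReal.toReal_pos hs0 hs).ne'
  rw [setAverage_eq, setAverage_eq, integral_sub hψ (integrableOn_const hs), setIntegral_const,
    smul_eq_mul, smul_eq_mul, smul_eq_mul]
  field_simp

theorem IsUnitBMO.sub_const {n : ℕ} {Ω : Set (Rn n)} {ψ : Rn n → ℝ} (H : IsUnitBMO Ω ψ) (k : ℝ) :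
    IsUnitBMO Ω fun x => ψ x - k := by
  refine ⟨H.measurable.sub_const k, fun c r hr hc => (H.integrableOn c r hr hc).sub
    (integrableOn_const (volume_ball_ne_top_rn c r)), fun c r hr hc => ?_⟩
  rw [setAverage_sub_const (H.integrableOn c r hr hc) (volume_ball_pos_rn c hr)
    (volume_ball_ne_top_rn c r)]
  simpa only [sub_sub_sub_cancel_right] using H.osc c r hr hc

/-- Interpolation for functions of unit mean oscillation on a Lipschitz domain whose average over
the domain is at most one. -/
theorem IsLipschitzDomain.exists_isUnitBMO_average_le {n : ℕ} {Ω : Set (Rn n)}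
    (hΩ : IsLipschitzDomain Ω) (hne : Ωᶜ.Nonempty) {p q : ℝ} (hp : 1 ≤ p) (hpq : p ≤ q) :
    ∃ C : ℝ≥0∞, C ≠ ⊤ ∧ ∀ ψ : Rn n → ℝ, IsUnitBMO Ω ψ → ‖⨍ y in Ω, ψ y‖ₑ ≤ 1 →
      ∫⁻ x in Ω, ‖ψ x‖ₑ ≤ C * volume Ω ∧
        ∫⁻ x in Ω, ‖ψ x‖ₑ ^ q ≤ C * ∫⁻ x in Ω, ‖ψ x‖ₑ ^ p := by
  obtain ⟨x₀, hx₀⟩ := hΩ.2.1.nonempty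
  have hv0 : volume Ω ≠ 0 := (hΩ.1.measure_pos volume ⟨x₀, hx₀⟩).ne'
  have hvt : volume Ω ≠ ⊤ := hΩ.2.2.1.measure_lt_top.ne
  have hpos := infDist_compl_pos hΩ.1 hne hx₀
  have hr : 0 < 1 / 4 * infDist x₀ Ωᶜ := by positivity
  have hcb : closedBall x₀ (1 / 4 * infDist x₀ Ωᶜ) ⊆ Ω :=
    closedBall_subset_of_lt_infDist_compl (by linarith)
  obtain ⟨C, hC, h⟩ := hΩ.exists_isUnitBMO_lintegral_le hne hx₀ (Λ := 0) (by simp)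
  have h1t : C + 1 ≠ ⊤ := ENNReal.add_ne_top.2 ⟨hC, ENNReal.one_ne_top⟩
  obtain ⟨C', hC', h'⟩ := hΩ.exists_isUnitBMO_lintegral_le hne hx₀ h1t
  obtain ⟨C'', hC'', h''⟩ := hΩ.exists_isUnitBMO_rpow_le hne hp hpq hx₀ h1t
  refine ⟨C' + C'', ENNReal.add_ne_top.2 ⟨hC', hC''⟩, fun ψ H hψ => ?_⟩
  set m := ⨍ y in ball x₀ (1 / 4 * infDist x₀ Ωᶜ), ψ y with hm
  have h1 := h _ (H.sub_const m) (by
    rw [setAverage_sub_const (H.integrableOn x₀ _ hr hcb) (volume_ball_pos_rn x₀ hr)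
      (volume_ball_ne_top_rn x₀ _), ← hm, sub_self, enorm_zero])
  have hψint : IntegrableOn ψ Ω := by
    have h2 : IntegrableOn (fun x => ψ x - m) Ω :=
      ⟨(H.measurable.sub_const m).aestronglyMeasurable,
        h1.trans_lt (ENNReal.mul_lt_top hC.lt_top hvt.lt_top)⟩
    refine (h2.add (integrableOn_const (C := m) hvt)).congr_fun (fun x _ => ?_)
      hΩ.1.measurableSet
    simp
  have h2 : ‖(⨍ y in Ω, ψ y) - m‖ₑ ≤ C :=
    (ENNReal.mul_le_mul_iff_left hv0 hvt).1 ((enorm_setAverage_sub_mul_le hψint hvt m).trans h1)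
  have h3 : ‖m‖ₑ ≤ C + 1 := by
    have h4 := enorm_sub_le (a := ⨍ y in Ω, ψ y) (b := (⨍ y in Ω, ψ y) - m)
    rw [sub_sub_cancel] at h4
    rw [add_comm]
    exact h4.trans (add_le_add hψ h2)
  exact ⟨(h' ψ H h3).trans (by gcongr; exact le_self_add),
    (h'' ψ H h3).trans (by gcongr; exact le_add_self)⟩

theorem lintegral_enorm_eq_zero_of_forall_le {α : Type*} [MeasurableSpace α] {μ : Measure α}
    {g : α → ℝ≥0∞} {D : ℝ≥0∞} (hD : D ≠ ⊤)
    (h : ∀ b : ℝ, 0 < b → ∫⁻ x, g x ∂μ ≤ ENNReal.ofReal b * D) : ∫⁻ x, g x ∂μ = 0 := by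
  have h1 := ENNReal.Tendsto.mul_const
    (ENNReal.tendsto_ofReal (tendsto_one_div_add_atTop_nhds_zero_nat (𝕜 := ℝ))) (Or.inr hD)
  rw [ENNReal.ofReal_zero, zero_mul] at h1
  exact le_antisymm (ge_of_tendsto' h1 fun k => h _ (by positivity)) zero_le

theorem IsLipschitzDomain.exists_setLIntegral_rpow_le_bmo {n : ℕ} {Ω : Set (Rn n)}
    (hΩ : IsLipschitzDomain Ω) (hne : Ωᶜ.Nonempty) {p q : ℝ} (hp : 1 ≤ p) (hpq : p < q) :
    ∃ C : ℝ≥0∞, C ≠ ⊤ ∧ ∀ ψ : Rn n → ℝ, Measurable ψ →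
      (∀ c r, 0 < r → closedBall c r ⊆ Ω → IntegrableOn ψ (ball c r)) → bmo Ω ψ < ⊤ →
      ∫⁻ x in Ω, ‖ψ x‖ₑ ^ q ≤ C * (bmo Ω ψ + ENNReal.ofReal |⨍ x in Ω, ψ x|) ^ (q - p) *
        ∫⁻ x in Ω, ‖ψ x‖ₑ ^ p := by
  obtain ⟨C, hC, h⟩ := hΩ.exists_isUnitBMO_average_le hne hp hpq.le
  have hvt : volume Ω ≠ ⊤ := hΩ.2.2.1.measure_lt_top.ne
  refine ⟨C, hC, fun ψ hψ hψint hbmo => ?_⟩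
  obtain ⟨T, hT⟩ : ∃ T, T = bmo Ω ψ + ENNReal.ofReal |⨍ x in Ω, ψ x| := ⟨_, rfl⟩
  have hscale : ∀ b : ℝ, 0 < b → ∀ x, ‖ψ x‖ₑ = ENNReal.ofReal b * ‖b⁻¹ * ψ x‖ₑ := by
    intro b hb x
    rw [← Real.enorm_of_nonneg hb.le, ← enorm_mul, mul_inv_cancel_left₀ hb.ne']
  have hunit : ∀ b : ℝ, 0 < b → T ≤ ENNReal.ofReal b →
      ∫⁻ x in Ω, ‖b⁻¹ * ψ x‖ₑ ≤ C * volume Ω ∧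
        ∫⁻ x in Ω, ‖b⁻¹ * ψ x‖ₑ ^ q ≤ C * ∫⁻ x in Ω, ‖b⁻¹ * ψ x‖ₑ ^ p := by
    intro b hb hTb
    refine h _ (isUnitBMO_of_bmo_le hψ hψint hb (le_self_add.trans (hT ▸ hTb))) ?_
    have h1 : ENNReal.ofReal |⨍ x in Ω, ψ x| ≤ ENNReal.ofReal b := le_add_self.trans (hT ▸ hTb)
    rw [setAverage_const_mul, enorm_mul, ← ofReal_norm (⨍ x in Ω, ψ x), Real.norm_eq_abs,
      Real.enorm_of_nonneg (inv_nonneg.2 hb.le)]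
    refine (mul_le_mul_right h1 _).trans (le_of_eq ?_)
    rw [← ENNReal.ofReal_mul (inv_nonneg.2 hb.le), inv_mul_cancel₀ hb.ne', ENNReal.ofReal_one]
  rw [← hT]
  rcases eq_or_ne T 0 with hT0 | hT0
  · have hz : ∫⁻ x in Ω, ‖ψ x‖ₑ = 0 := by
      refine lintegral_enorm_eq_zero_of_forall_le (ENNReal.mul_ne_top hC hvt) fun b hb => ?_
      simp only [hscale b hb]
      rw [lintegral_const_mul' _ _ ENNReal.ofReal_ne_top]
      exact mul_le_mul_right (hunit b hb (by simp [hT0])).1 _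
    rw [lintegral_eq_zero_iff hψ.enorm] at hz
    have hz' : ∫⁻ x in Ω, ‖ψ x‖ₑ ^ q = 0 := by
      rw [lintegral_eq_zero_iff (hψ.enorm.pow_const q)]
      filter_upwards [hz] with x hx
      simp only [Pi.zero_apply] at hx ⊢
      rw [hx, ENNReal.zero_rpow_of_pos (by linarith)]
    rw [hz']
    exact zero_le
  · have hTt : T ≠ ⊤ := by
      rw [hT]
      exact ENNReal.add_ne_top.2 ⟨hbmo.ne, ENNReal.ofReal_ne_top⟩
    have hb := ENNReal.toReal_pos hT0 hTt
    have e := ENNReal.ofReal_toReal hTt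
    have hpow : ∀ s : ℝ, 0 ≤ s →
        ∫⁻ x in Ω, ‖ψ x‖ₑ ^ s = T ^ s * ∫⁻ x in Ω, ‖T.toReal⁻¹ * ψ x‖ₑ ^ s := by
      intro s hs
      rw [← lintegral_const_mul' _ _ (ENNReal.rpow_ne_top_of_nonneg hs hTt)]
      refine lintegral_congr fun x => ?_
      rw [← ENNReal.mul_rpow_of_nonneg _ _ hs, hscale _ hb x, e]
    rw [hpow q (by linarith), hpow p (by linarith)]
    refine (mul_le_mul_right (hunit _ hb e.ge).2 _).trans (le_of_eq ?_)
    have h1 : T ^ q = T ^ (q - p) * T ^ p := by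
      rw [← ENNReal.rpow_add_of_nonneg _ _ (by linarith) (by linarith), sub_add_cancel]
    rw [h1]
    ring

theorem mo_congr_ae {n : ℕ} {Q : Set (Rn n)} {ψ φ : Rn n → ℝ} (h : ψ =ᵐ[volume.restrict Q] φ) :
    mo Q ψ = mo Q φ := by
  rw [mo, mo, average_congr h]
  congr 1
  refine lintegral_congr_ae ?_
  filter_upwards [h] with x hx
  rw [hx]

theorem bmo_congr_ae {n : ℕ} {Ω : Set (Rn n)} {ψ φ : Rn n → ℝ}
    (h : ψ =ᵐ[volume.restrict Ω] φ) : bmo Ω ψ = bmo Ω φ :=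
  iSup_congr fun _ => iSup_congr fun hQ => mo_congr_ae
    (ae_restrict_of_ae_restrict_of_subset (subset_closure.trans hQ.2) h)

theorem setLIntegral_rpow_le_of_subsingleton {n : ℕ} [Subsingleton (Rn n)] {Ω : Set (Rn n)}
    (hΩ : IsLipschitzDomain Ω) {p q : ℝ} (hp : 0 ≤ p) (hpq : p ≤ q) (ψ : Rn n → ℝ) :
    ∫⁻ x in Ω, ‖ψ x‖ₑ ^ q ≤ (bmo Ω ψ + ENNReal.ofReal |⨍ x in Ω, ψ x|) ^ (q - p) *
      ∫⁻ x in Ω, ‖ψ x‖ₑ ^ p := by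
  obtain ⟨x₀, hx₀⟩ := hΩ.2.1.nonempty
  have hv0 : volume Ω ≠ 0 := (hΩ.1.measure_pos volume ⟨x₀, hx₀⟩).ne'
  have hvt : volume Ω ≠ ⊤ := hΩ.2.2.1.measure_lt_top.ne
  have hψ : ψ = fun _ => ψ x₀ := funext fun x => congrArg ψ (Subsingleton.elim x x₀)
  have hav : ⨍ x in Ω, ψ x = ψ x₀ := by
    rw [hψ]
    exact setAverage_const hv0 hvt _
  rw [hav, hψ]
  simp only [setLIntegral_const]
  rw [← mul_assoc]
  gcongr
  refine ENNReal.rpow_le_rpow_sub_mul_rpow ?_ hp hpq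
  rw [← Real.norm_eq_abs, ofReal_norm]
  exact le_add_self

/-- Interpolation inequality on a bounded Lipschitz domain:
`∫_Ω |ψ|^q ≤ C ([ψ]_{BMO(Ω)} + |⟨ψ⟩_Ω|)^{q-p} ∫_Ω |ψ|^p` for all `ψ ∈ BMO(Ω)`. -/
theorem lintegral_rpow_le_of_bmo {n : ℕ} (Ω : Set (Rn n)) (hΩ : IsLipschitzDomain Ω)
    (p q : ℝ) (hp : 1 ≤ p) (hpq : p < q) :
    ∃ C : ℝ, 0 < C ∧ ∀ ψ : Rn n → ℝ, LocallyIntegrableOn ψ Ω → bmo Ω ψ < ⊤ →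
      ∫⁻ x in Ω, (‖ψ x‖₊ : ℝ≥0∞) ^ q ≤
        ENNReal.ofReal C * (bmo Ω ψ + ENNReal.ofReal |⨍ x in Ω, ψ x|) ^ (q - p) *
          ∫⁻ x in Ω, (‖ψ x‖₊ : ℝ≥0∞) ^ p := by
  rcases Ωᶜ.eq_empty_or_nonempty with hne | hne
  · have hsub : Subsingleton (Rn n) := by
      by_contra h
      have := not_subsingleton_iff_nontrivial.1 h
      have hb := hΩ.2.2.1
      rw [Set.compl_empty_iff.1 hne] at hb
      exact NormedSpace.unbounded_univ ℝ (Rn n) hb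
    refine ⟨1, one_pos, fun ψ _ _ => ?_⟩
    rw [ENNReal.ofReal_one, one_mul]
    exact setLIntegral_rpow_le_of_subsingleton hΩ (by linarith) hpq.le ψ
  · obtain ⟨C, hC, h⟩ := hΩ.exists_setLIntegral_rpow_le_bmo hne hp hpq
    refine ⟨C.toReal + 1, by positivity, fun ψ hloc hbmo => ?_⟩
    have hCle : C ≤ ENNReal.ofReal (C.toReal + 1) :=
      (ENNReal.ofReal_toReal hC).symm.trans_le (ENNReal.ofReal_le_ofReal (by linarith))
    have hae := hloc.aestronglyMeasurable
    have heq := hae.ae_eq_mk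
    have hψint : ∀ c r, 0 < r → closedBall c r ⊆ Ω → IntegrableOn (hae.mk ψ) (ball c r) := by
      intro c r _ hc
      refine (((hloc.integrableOn_compact_subset hc (isCompact_closedBall c r)).mono_set
        ball_subset_closedBall).congr_fun_ae ?_)
      exact ae_restrict_of_ae_restrict_of_subset (ball_subset_closedBall.trans hc) heq
    have hmain := h _ hae.stronglyMeasurable_mk.measurable hψint (by rwa [← bmo_congr_ae heq])
    rw [← bmo_congr_ae heq, ← average_congr heq] at hmain
    have hpow : ∀ s : ℝ, ∫⁻ x in Ω, ‖hae.mk ψ x‖ₑ ^ s = ∫⁻ x in Ω, ‖ψ x‖ₑ ^ s := by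
      intro s
      refine lintegral_congr_ae ?_
      filter_upwards [heq] with x hx
      rw [hx]
    rw [hpow, hpow] at hmain
    exact hmain.trans (mul_le_mul_left (mul_le_mul_left hCle _) _)
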